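/- arXiv:2310.01948 — 2 statements merged into one kernel-verified Lean document; each statement's English description precedes it below -/
import Mathlib

section
/- Let m ≥ 1 and p ≥ 0 be integers, b_j ∈ ℝ, β_j > 0 with b_j + β_j > 0 for 1 ≤ j ≤ m, a_i ∈ ℝ, α_i > 0 with a_i + α_i > 0 for 1 ≤ i ≤ p, Δ = Σ_{j=1}^m β_j − Σ_{i=1}^p α_i > 0, and suppose the poles −(b_j+l)/β_j (1 ≤ j ≤ m, l ∈ ℕ) are pairwise distinct. Let γ > max_{1≤j≤m}(−b_j/β_j) and H(x) = (1/(2π)) ∫_{t∈ℝ} [Π_{j=1}^m Γ(b_j+β_j(γ+it)) / Π_{i=1}^p Γ(a_i+α_i(γ+it))] x^{−(γ+it)} dt for x > 0. Then, with μ = Σ_{j=1}^m b_j − Σ_{i=1}^p a_i + (p−m)/2 and δ = Π_{j=1}^m β_j^{β_j} · Π_{i=1}^p α_i^{−α_i}, one has H(x) = O( x^{(μ+1/2)/Δ} · exp(−Δ δ^{−1/Δ} x^{1/Δ}) ) as x → +∞. -/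
open MeasureTheory Finset Filter Complex Real Asymptotics

/-- The Fox-H kernel of type `(m,0;p,m)`: `𝓗(s) = ∏_{j<m} Γ(bⱼ+βⱼs) / ∏_{i<p} Γ(aᵢ+αᵢs)`. -/
noncomputable def foxKernelM (m p : ℕ) (a α b β : ℕ → ℝ) (s : ℂ) : ℂ :=
  (∏ j ∈ Finset.range m, Complex.Gamma (b j + β j * s)) /
  (∏ i ∈ Finset.range p, Complex.Gamma (a i + α i * s))

/-- The corresponding Fox-H function on `(0,∞)` defined by the vertical contour `L_{iγ∞}`. -/
noncomputable def foxHposM (m p : ℕ) (a α b β : ℕ → ℝ) (γ : ℝ) (x : ℝ) : ℂ :=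
  (1 / (2 * π)) * ∫ t : ℝ, foxKernelM m p a α b β ((γ : ℂ) + (t : ℂ) * Complex.I) *
    Complex.exp (-((γ : ℂ) + (t : ℂ) * Complex.I) * (Real.log x : ℂ))

/-- The phase function governing the decay of `Γ(x + iy) / Γ(x)`: the integral
`∫_x^∞ ½ log (1 + y² / v²) dv` in closed form. -/
noncomputable def gammaPhase (x y : ℝ) : ℝ :=
  y * Real.arctan (y / x) - x / 2 * Real.log (1 + y ^ 2 / x ^ 2)

lemma gammaPhase_smul {r : ℝ} (hr : 0 < r) (x y : ℝ) :
    gammaPhase (r * x) (r * y) = r * gammaPhase x y := by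
  unfold gammaPhase
  rw [mul_div_mul_left _ _ hr.ne', mul_pow, mul_pow, mul_div_mul_left _ _ (by positivity)]
  ring

lemma gammaPhase_abs (x y : ℝ) : gammaPhase x |y| = gammaPhase x y := by
  rcases abs_cases y with ⟨h, _⟩ | ⟨h, _⟩
  · rw [h]
  · rw [h]
    unfold gammaPhase
    rw [neg_div, Real.arctan_neg, neg_sq]
    ring

lemma hasDerivAt_gammaPhase {x : ℝ} (hx : 0 < x) (y : ℝ) :
    HasDerivAt (fun v => gammaPhase v y) (-(Real.log (1 + y ^ 2 / x ^ 2) / 2)) x := by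
  have h1 : HasDerivAt (fun v : ℝ => y / v) (-(y / x ^ 2)) x := by
    simpa [div_eq_mul_inv] using (hasDerivAt_inv hx.ne').const_mul y
  have h2 : HasDerivAt (fun v : ℝ => 1 + y ^ 2 / v ^ 2) (-(2 * y ^ 2 / x ^ 3)) x := by
    have h := (h1.pow 2).const_add 1
    have e : (fun v : ℝ => 1 + (y / v) ^ 2) = fun v : ℝ => 1 + y ^ 2 / v ^ 2 := by
      simp only [div_pow]
    rw [← e]
    refine h.congr_deriv ?_
    simp only [Nat.cast_ofNat, Nat.add_one_sub_one, pow_one]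
    field_simp
  have hpos : 0 < 1 + y ^ 2 / x ^ 2 := by positivity
  have h3 := (h1.arctan.const_mul y).sub
    (((hasDerivAt_id x).div_const 2).mul (h2.log hpos.ne'))
  refine (h3.congr_deriv ?_)
  simp only [id]
  field_simp
  ring

lemma gammaPhase_sub_mem {x x' : ℝ} (hx : 0 < x) (h : x ≤ x') (y : ℝ) :
    Real.log (1 + y ^ 2 / x' ^ 2) / 2 * (x' - x) ≤ gammaPhase x y - gammaPhase x' y ∧
    gammaPhase x y - gammaPhase x' y ≤ Real.log (1 + y ^ 2 / x ^ 2) / 2 * (x' - x) := by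
  rcases h.eq_or_lt with rfl | h
  · simp
  obtain ⟨c, hc, he⟩ := exists_hasDerivAt_eq_slope (fun v => gammaPhase v y) _ h
    (fun v hv => (hasDerivAt_gammaPhase (hx.trans_le hv.1) y).continuousAt.continuousWithinAt)
    (fun v hv => hasDerivAt_gammaPhase (hx.trans hv.1) y)
  have hc0 : 0 < c := hx.trans hc.1
  have e : gammaPhase x y - gammaPhase x' y = Real.log (1 + y ^ 2 / c ^ 2) / 2 * (x' - x) := by
    rw [eq_div_iff (sub_pos.2 h).ne'] at he
    linarith
  have hx' : 0 < x' := hx.trans h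
  have hc1 := hc.1.le
  have hc2 := hc.2.le
  have hd := sub_pos.2 h
  rw [e]
  constructor <;> gcongr

lemma tendsto_gammaPhase_atTop (y : ℝ) :
    Tendsto (fun x => gammaPhase x y) atTop (nhds 0) := by
  have h0 : Tendsto (fun x : ℝ => y / x) atTop (nhds 0) := tendsto_const_nhds.div_atTop tendsto_id
  have h1 : Tendsto (fun x : ℝ => y * Real.arctan (y / x)) atTop (nhds 0) := by
    simpa using ((Real.continuous_arctan.tendsto 0).comp h0).const_mul y
  have h2 : Tendsto (fun x : ℝ => x / 2 * Real.log (1 + y ^ 2 / x ^ 2)) atTop (nhds 0) := by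
    refine squeeze_zero' (g := fun x => y / 2 * (y / x)) ?_ ?_ (by simpa using h0.const_mul (y / 2))
    · filter_upwards [eventually_gt_atTop 0] with x hx
      have : 0 ≤ Real.log (1 + y ^ 2 / x ^ 2) := Real.log_nonneg (by
        have : 0 ≤ y ^ 2 / x ^ 2 := by positivity
        linarith)
      positivity
    · filter_upwards [eventually_gt_atTop 0] with x hx
      have h : Real.log (1 + y ^ 2 / x ^ 2) ≤ y ^ 2 / x ^ 2 := by
        have := Real.log_le_sub_one_of_pos (x := 1 + y ^ 2 / x ^ 2) (by positivity)
        linarith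
      calc x / 2 * Real.log (1 + y ^ 2 / x ^ 2) ≤ x / 2 * (y ^ 2 / x ^ 2) := by gcongr
        _ = y / 2 * (y / x) := by field_simp
  simpa [gammaPhase] using h1.sub h2

lemma pi_half_mul_abs_sub_le_gammaPhase {x : ℝ} (hx : 0 < x) (y : ℝ) :
    Real.pi / 2 * |y| - x - x / 2 * Real.log (1 + y ^ 2 / x ^ 2) ≤ gammaPhase x y := by
  rw [← gammaPhase_abs, gammaPhase, sq_abs]
  gcongr
  rcases eq_or_ne y 0 with rfl | hy
  · simpa using hx.le
  have hy' : 0 < |y| := abs_pos.2 hy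
  have h1 : Real.arctan (|y| / x) = Real.pi / 2 - Real.arctan (x / |y|) := by
    rw [← Real.arctan_inv_of_pos (by positivity), inv_div]
  have h2 : Real.arctan (x / |y|) ≤ x / |y| := by
    simpa using Real.le_tan (Real.arctan_nonneg.2 (by positivity : 0 ≤ x / |y|))
      (Real.arctan_lt_pi_div_two _)
  rw [h1]
  have : |y| * Real.arctan (x / |y|) ≤ x := by
    calc _ ≤ |y| * (x / |y|) := by gcongr
      _ = x := by field_simp
  linarith

lemma gammaPhase_le_pi_half_mul_abs {x : ℝ} (hx : 0 < x) (y : ℝ) :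
    gammaPhase x y ≤ Real.pi / 2 * |y| := by
  rw [← gammaPhase_abs, gammaPhase, sq_abs]
  have h0 : 0 ≤ x / 2 * Real.log (1 + y ^ 2 / x ^ 2) := by
    have : 0 ≤ Real.log (1 + y ^ 2 / x ^ 2) := Real.log_nonneg (by
      have : 0 ≤ y ^ 2 / x ^ 2 := by positivity
      linarith)
    positivity
  have := mul_le_mul_of_nonneg_left (Real.arctan_lt_pi_div_two (|y| / x)).le (abs_nonneg y)
  linarith

lemma div_one_add_le_arctan {u : ℝ} (hu : 0 ≤ u) : u / (1 + u) ≤ Real.arctan u := by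
  have hd : ∀ v : ℝ, 0 ≤ v →
      HasDerivAt (fun v => Real.arctan v - v / (1 + v)) (1 / (1 + v ^ 2) - 1 / (1 + v) ^ 2) v := by
    intro v hv
    have h1 := (Real.hasDerivAt_arctan v).sub
      ((hasDerivAt_id v).div ((hasDerivAt_id v).const_add 1) (by simp only [id]; positivity))
    refine h1.congr_deriv ?_
    simp
  have hm : MonotoneOn (fun v => Real.arctan v - v / (1 + v)) (Set.Ici 0) := by
    refine monotoneOn_of_hasDerivWithinAt_nonneg (convex_Ici 0)
      (fun v hv => (hd v hv).continuousAt.continuousWithinAt)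
      (fun v hv => (hd v (interior_subset hv)).hasDerivWithinAt) ?_
    intro v hv
    have hv : 0 ≤ v := interior_subset hv
    rw [sub_nonneg]
    gcongr
    nlinarith
  have := hm Set.self_mem_Ici (Set.mem_Ici.2 hu) hu
  simp at this
  linarith

lemma sq_div_le_gammaPhase_one (y : ℝ) : y ^ 2 / (2 * (1 + |y|)) ≤ gammaPhase 1 y := by
  rw [← gammaPhase_abs, ← sq_abs]
  have hd : ∀ v : ℝ, 0 ≤ v → HasDerivAt (fun v => gammaPhase 1 v - v ^ 2 / (2 * (1 + v)))
      (Real.arctan v - (2 * v + v ^ 2) / (2 * (1 + v) ^ 2)) v := by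
    intro v hv
    have h1 := ((hasDerivAt_id v).mul (Real.hasDerivAt_arctan v)).sub
      ((((hasDerivAt_pow 2 v).const_add 1).log (by positivity)).const_mul (1 / 2))
    have h2 := (hasDerivAt_pow 2 v).div (((hasDerivAt_id v).const_add 1).const_mul 2)
      (by simp only [id]; positivity)
    have h3 := h1.sub h2
    simp only [gammaPhase, div_one, one_pow]
    refine h3.congr_deriv ?_
    simp only [id, Nat.cast_ofNat]
    field_simp
    ring
  have hm : MonotoneOn (fun v => gammaPhase 1 v - v ^ 2 / (2 * (1 + v))) (Set.Ici 0) := by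
    refine monotoneOn_of_hasDerivWithinAt_nonneg (convex_Ici 0)
      (fun v hv => (hd v hv).continuousAt.continuousWithinAt)
      (fun v hv => (hd v (interior_subset hv)).hasDerivWithinAt) ?_
    intro v hv
    have hv : 0 ≤ v := interior_subset hv
    rw [sub_nonneg]
    refine le_trans ?_ (div_one_add_le_arctan hv)
    rw [div_le_div_iff₀ (by positivity) (by positivity)]
    nlinarith [pow_nonneg hv 3, pow_nonneg hv 2]
  have := hm Set.self_mem_Ici (Set.mem_Ici.2 (abs_nonneg y)) (abs_nonneg y)
  simp [gammaPhase] at this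
  simp only [gammaPhase, div_one, one_pow, sq_abs]
  linarith

lemma sq_div_le_gammaPhase {x : ℝ} (hx : 0 < x) (y : ℝ) :
    y ^ 2 / (2 * (x + |y|)) ≤ gammaPhase x y := by
  have h := gammaPhase_smul hx 1 (y / x)
  rw [mul_one, mul_div_cancel₀ _ hx.ne'] at h
  rw [h]
  refine le_trans (le_of_eq ?_) (mul_le_mul_of_nonneg_left (sq_div_le_gammaPhase_one (y / x)) hx.le)
  rw [abs_div, abs_of_pos hx]
  field_simp

lemma log_one_add_sq_div_nonneg (x y : ℝ) : 0 ≤ Real.log (1 + y ^ 2 / x ^ 2) :=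
  Real.log_nonneg (le_add_of_nonneg_right (by positivity))

lemma norm_ofReal_add_ofReal_mul_I {x : ℝ} (hx : 0 < x) (y : ℝ) :
    ‖(x : ℂ) + y * Complex.I‖ = x * Real.exp (Real.log (1 + y ^ 2 / x ^ 2) / 2) := by
  have h : 0 < 1 + y ^ 2 / x ^ 2 := by positivity
  rw [Complex.norm_add_mul_I, ← Real.log_sqrt h.le, Real.exp_log (Real.sqrt_pos.2 h)]
  rw [show x ^ 2 + y ^ 2 = x ^ 2 * (1 + y ^ 2 / x ^ 2) by field_simp,
    Real.sqrt_mul (by positivity), Real.sqrt_sq hx.le]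

lemma norm_GammaSeq {x : ℝ} (hx : 0 < x) (y : ℝ) {n : ℕ} (hn : 0 < n) :
    ‖Complex.GammaSeq (x + y * Complex.I) n‖ = Real.GammaSeq x n *
      Real.exp (-∑ k ∈ Finset.range (n + 1), Real.log (1 + y ^ 2 / (x + k) ^ 2) / 2) := by
  have hre : ((x : ℂ) + y * Complex.I).re = x := by simp
  have hk : ∀ k : ℕ, ‖(x : ℂ) + y * Complex.I + k‖ =
      (x + k) * Real.exp (Real.log (1 + y ^ 2 / (x + k) ^ 2) / 2) := by
    intro k
    rw [← norm_ofReal_add_ofReal_mul_I (by positivity)]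
    push_cast
    congr 1
    ring
  rw [Complex.GammaSeq, Real.GammaSeq, norm_div, norm_mul,
    Complex.norm_natCast_cpow_of_pos hn, hre, norm_prod, Finset.prod_congr rfl (fun k _ => hk k),
    Finset.prod_mul_distrib, ← Real.exp_sum, Real.exp_neg, Complex.norm_natCast]
  field_simp

lemma sum_range_log_mem {x : ℝ} (hx : 0 < x) (y : ℝ) (n : ℕ) :
    gammaPhase x y - gammaPhase (x + n) y ≤
      ∑ k ∈ Finset.range n, Real.log (1 + y ^ 2 / (x + k) ^ 2) / 2 ∧
    ∑ k ∈ Finset.range n, Real.log (1 + y ^ 2 / (x + k) ^ 2) / 2 ≤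
      gammaPhase x y - gammaPhase (x + n) y + Real.log (1 + y ^ 2 / x ^ 2) / 2
        - Real.log (1 + y ^ 2 / (x + n) ^ 2) / 2 := by
  induction n with
  | zero => simp
  | succ n ih =>
    have hn : 0 < x + n := by positivity
    have h := gammaPhase_sub_mem hn (x' := x + (n + 1 : ℕ)) (by push_cast; linarith) y
    have e : x + ((n + 1 : ℕ) : ℝ) - (x + n) = 1 := by push_cast; ring
    rw [e, mul_one, mul_one] at h
    rw [Finset.sum_range_succ]
    constructor
    · linarith [ih.1, h.2]
    · linarith [ih.2, h.1]

lemma tendsto_gammaPhase_add_nat (x y : ℝ) :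
    Tendsto (fun n : ℕ => gammaPhase (x + (n + 1 : ℕ)) y) atTop (nhds 0) :=
  (tendsto_gammaPhase_atTop y).comp (tendsto_atTop_add_const_left _ _
    (tendsto_natCast_atTop_atTop.comp (tendsto_add_atTop_nat 1)))

lemma GammaSeq_nonneg {x : ℝ} (hx : 0 < x) (n : ℕ) : 0 ≤ Real.GammaSeq x n := by
  unfold Real.GammaSeq
  have : 0 ≤ ∏ j ∈ Finset.range (n + 1), (x + j) := Finset.prod_nonneg fun j _ => by positivity
  positivity

lemma norm_Gamma_le {x : ℝ} (hx : 0 < x) (y : ℝ) :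
    ‖Complex.Gamma (x + y * Complex.I)‖ ≤ Real.Gamma x * Real.exp (-gammaPhase x y) := by
  have h1 := (Complex.GammaSeq_tendsto_Gamma (x + y * Complex.I)).norm
  have h2 := (Real.GammaSeq_tendsto_Gamma x).mul
    ((((tendsto_gammaPhase_add_nat x y).const_sub (gammaPhase x y)).neg).rexp)
  rw [sub_zero] at h2
  refine le_of_tendsto_of_tendsto h1 h2 ?_
  filter_upwards [eventually_gt_atTop 0] with n hn
  rw [norm_GammaSeq hx y hn]
  have := (sum_range_log_mem hx y (n + 1)).1
  have := GammaSeq_nonneg hx n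
  gcongr

lemma le_norm_Gamma {x : ℝ} (hx : 0 < x) (y : ℝ) :
    Real.Gamma x * Real.exp (-(gammaPhase x y + Real.log (1 + y ^ 2 / x ^ 2) / 2)) ≤
      ‖Complex.Gamma (x + y * Complex.I)‖ := by
  have h1 := (Complex.GammaSeq_tendsto_Gamma (x + y * Complex.I)).norm
  have h2 := (Real.GammaSeq_tendsto_Gamma x).mul
    (((((tendsto_gammaPhase_add_nat x y).const_sub (gammaPhase x y)).add_const
      (Real.log (1 + y ^ 2 / x ^ 2) / 2)).neg).rexp)
  rw [sub_zero] at h2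
  refine le_of_tendsto_of_tendsto h2 h1 ?_
  filter_upwards [eventually_gt_atTop 0] with n hn
  rw [norm_GammaSeq hx y hn]
  have h3 := (sum_range_log_mem hx y (n + 1)).2
  have h4 := log_one_add_sq_div_nonneg (x + (n + 1 : ℕ)) y
  have := GammaSeq_nonneg hx n
  gcongr
  linarith

/-- `log |Γ(x + iy)|` differs from `log Γ(x) - gammaPhase x y` by at most `½ log (1 + y² / x²)`. -/
lemma abs_log_norm_Gamma_sub_le {x : ℝ} (hx : 0 < x) (y : ℝ) :
    |Real.log ‖Complex.Gamma (x + y * Complex.I)‖ - (Real.log (Real.Gamma x) - gammaPhase x y)| ≤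
      Real.log (1 + y ^ 2 / x ^ 2) / 2 := by
  have hG := Real.Gamma_pos_of_pos hx
  have h1 := norm_Gamma_le hx y
  have h2 := le_norm_Gamma hx y
  have hpos : 0 < ‖Complex.Gamma (x + y * Complex.I)‖ := lt_of_lt_of_le (by positivity) h2
  have h3 := Real.log_le_log hpos h1
  have h4 := Real.log_le_log (by positivity) h2
  rw [Real.log_mul hG.ne' (Real.exp_pos _).ne', Real.log_exp] at h3 h4
  have := log_one_add_sq_div_nonneg x y
  rw [abs_le]
  constructor <;> linarith

lemma exists_forall_le_of_add_one_le {f : ℝ → ℝ} (hf : ContinuousOn f (Set.Icc 1 2))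
    (h : ∀ w, 1 ≤ w → f (w + 1) ≤ f w) : ∃ C, ∀ w, 1 ≤ w → f w ≤ C := by
  obtain ⟨C, hC⟩ := isCompact_Icc.bddAbove_image hf
  have key : ∀ n : ℕ, ∀ w : ℝ, 1 ≤ w → w ≤ n + 2 → f w ≤ C := by
    intro n
    induction n with
    | zero =>
      intro w h1 h2
      exact hC ⟨w, ⟨h1, by simpa using h2⟩, rfl⟩
    | succ n ih =>
      intro w h1 h2
      by_cases hw : w ≤ n + 2
      · exact ih w h1 hw
      · push Not at hw
        push_cast at h2
        have hn : (0 : ℝ) ≤ n := n.cast_nonneg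
        have h3 := h (w - 1) (by linarith)
        rw [sub_add_cancel] at h3
        exact h3.trans (ih _ (by linarith) (by linarith))
  refine ⟨C, fun w hw => ?_⟩
  obtain ⟨n, hn⟩ := exists_nat_ge w
  exact key n w hw (by linarith)

lemma stirling_step_mem {w : ℝ} (hw : 0 < w) :
    1 ≤ (w + 1 / 2) * (Real.log (w + 1) - Real.log w) ∧
    (w + 1 / 2) * (Real.log (w + 1) - Real.log w) ≤ 1 + 1 / 4 * (1 / w - 1 / (w + 1)) := by
  rw [← Real.log_div (by positivity) hw.ne']
  constructor
  · have h := Real.le_log_one_add_of_nonneg (x := 1 / w) (by positivity)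
    have e : 1 + 1 / w = (w + 1) / w := by field_simp
    rw [e] at h
    calc (1 : ℝ) = (w + 1 / 2) * (2 * (1 / w) / (1 / w + 2)) := by field_simp; ring
      _ ≤ _ := by gcongr
  · have ht : 1 ≤ (w + 1) / w := by rw [le_div_iff₀ hw]; linarith
    have h := Real.self_le_sinh_iff.2 (Real.log_nonneg ht)
    rw [Real.sinh_log (by positivity)] at h
    calc _ ≤ (w + 1 / 2) * (((w + 1) / w - ((w + 1) / w)⁻¹) / 2) := by gcongr
      _ = _ := by field_simp; ring

/-- The remainder in Stirling's formula for `log Γ` is bounded on `[1, ∞)`. -/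
lemma exists_abs_log_Gamma_sub_le : ∃ C, ∀ w : ℝ, 1 ≤ w →
    |Real.log (Real.Gamma w) - ((w - 1 / 2) * Real.log w - w)| ≤ C := by
  have hc : ContinuousOn (fun w => Real.log (Real.Gamma w) - ((w - 1 / 2) * Real.log w - w))
      (Set.Icc 1 2) := by
    intro w hw
    have hw0 : 0 < w := by linarith [hw.1]
    have h1 : ContinuousAt Real.Gamma w :=
      (Real.differentiableAt_Gamma fun m => by
        have : (0 : ℝ) ≤ m := m.cast_nonneg
        linarith).continuousAt
    have h2 := h1.log (Real.Gamma_pos_of_pos hw0).ne'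
    have h3 := Real.continuousAt_log hw0.ne'
    refine ContinuousAt.continuousWithinAt ?_
    fun_prop
  have hstep : ∀ w : ℝ, 1 ≤ w → Real.log (Real.Gamma (w + 1)) -
      ((w + 1 - 1 / 2) * Real.log (w + 1) - (w + 1)) =
      Real.log (Real.Gamma w) - ((w - 1 / 2) * Real.log w - w) + 1 -
        (w + 1 / 2) * (Real.log (w + 1) - Real.log w) := by
    intro w hw
    have hw0 : 0 < w := by linarith
    rw [Real.Gamma_add_one hw0.ne', Real.log_mul hw0.ne' (Real.Gamma_pos_of_pos hw0).ne']
    ring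
  obtain ⟨C₁, h₁⟩ := exists_forall_le_of_add_one_le hc fun w hw => by
    have := (stirling_step_mem (by linarith : 0 < w)).1
    have := hstep w hw
    linarith
  have hc' : ContinuousOn (fun w => 1 / 4 * (1 / w) -
      (Real.log (Real.Gamma w) - ((w - 1 / 2) * Real.log w - w))) (Set.Icc 1 2) := by
    refine ContinuousOn.sub (continuousOn_const.mul (continuousOn_const.div continuousOn_id ?_)) hc
    intro w hw
    exact (by linarith [hw.1] : (0 : ℝ) < w).ne'
  obtain ⟨C₂, h₂⟩ := exists_forall_le_of_add_one_le hc' fun w hw => by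
    have := (stirling_step_mem (by linarith : 0 < w)).2
    have := hstep w hw
    linarith
  refine ⟨max C₁ C₂, fun w hw => abs_le.2 ⟨?_, (h₁ w hw).trans (le_max_left _ _)⟩⟩
  have h3 := h₂ w hw
  have h4 : 0 ≤ 1 / 4 * (1 / w) := by positivity
  have := le_max_right C₁ C₂
  linarith

lemma exists_eventually_abs_log_Gamma_add_sub_le (b : ℝ) : ∃ C, ∀ᶠ w : ℝ in atTop,
    |Real.log (Real.Gamma (w + b)) - (w * Real.log w - w + (b - 1 / 2) * Real.log w)| ≤ C := by
  obtain ⟨C, hC⟩ := exists_abs_log_Gamma_sub_le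
  refine ⟨C + 4 * |b| + |b|, ?_⟩
  filter_upwards [eventually_ge_atTop (2 * |b| + 2)] with w hw
  have hb := abs_nonneg b
  have hb1 := neg_abs_le b
  have hb2 := le_abs_self b
  have hw0 : 0 < w := by linarith
  have hwb : 0 < w + b := by linarith
  have h1 := hC (w + b) (by linarith)
  have hlog : |Real.log (w + b) - Real.log w| ≤ 2 * |b| / w := by
    rw [← Real.log_div hwb.ne' hw0.ne', abs_le]
    have hd : 0 < (w + b) / w := by positivity
    constructor
    · refine le_trans ?_ (Real.one_sub_inv_le_log_of_pos hd)
      have e : 1 - ((w + b) / w)⁻¹ = b / (w + b) := by field_simp; ring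
      rw [e, ← neg_div, div_le_div_iff₀ hw0 hwb]
      nlinarith [mul_nonneg hb (by linarith : 0 ≤ w - 2 * |b|), mul_nonneg hb hwb.le]
    · refine (Real.log_le_sub_one_of_pos hd).trans ?_
      have e : (w + b) / w - 1 = b / w := by field_simp; ring
      rw [e]
      gcongr
      linarith
  have hcoef : |w + b - 1 / 2| ≤ 2 * w := by
    rw [abs_le]
    constructor <;> linarith
  have hprod : |(w + b - 1 / 2) * (Real.log (w + b) - Real.log w)| ≤ 4 * |b| := by
    rw [abs_mul]
    calc _ ≤ 2 * w * (2 * |b| / w) := by gcongr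
      _ = 4 * |b| := by field_simp; ring
  have e : Real.log (Real.Gamma (w + b)) - (w * Real.log w - w + (b - 1 / 2) * Real.log w) =
      (Real.log (Real.Gamma (w + b)) - ((w + b - 1 / 2) * Real.log (w + b) - (w + b))) +
      (w + b - 1 / 2) * (Real.log (w + b) - Real.log w) - b := by ring
  rw [e]
  exact (abs_sub _ _).trans (add_le_add ((abs_add_le _ _).trans (add_le_add h1 hprod)) le_rfl)

/-- The leading behaviour of `log |Γ(b + β(c + it))|` as `c → ∞`, uniformly in `t`. -/
noncomputable def gammaMainTerm (b β : ℝ) (z : ℝ × ℝ) : ℝ :=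
  β * (z.1 * Real.log z.1 - z.1) + z.1 * (β * Real.log β) + (b - 1 / 2) * Real.log z.1
    - β * gammaPhase z.1 z.2

lemma log_one_add_sq_div_le {x c y t β : ℝ} (hc : 0 < c) (hβ : 0 < β)
    (hx : β * c / 2 ≤ x) (hy : y = β * t) :
    Real.log (1 + y ^ 2 / x ^ 2) ≤ 2 + Real.log (1 + t ^ 2 / c ^ 2) := by
  have hx0 : 0 < β * c / 2 := by positivity
  have hx1 : 0 < x := hx0.trans_le hx
  have h1 : 1 + y ^ 2 / x ^ 2 ≤ 4 * (1 + t ^ 2 / c ^ 2) := by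
    calc 1 + y ^ 2 / x ^ 2 ≤ 1 + y ^ 2 / (β * c / 2) ^ 2 := by gcongr
      _ = 1 + 4 * (t ^ 2 / c ^ 2) := by rw [hy]; field_simp; norm_num
      _ ≤ _ := by linarith
  have h2 := Real.log_le_log (by positivity) h1
  rw [Real.log_mul (by norm_num) (by positivity)] at h2
  have h3 : Real.log 4 ≤ 2 := by
    have : Real.log 4 = 2 * Real.log 2 := by
      rw [show (4 : ℝ) = 2 ^ 2 by norm_num, Real.log_pow]; norm_num
    linarith [Real.log_two_lt_d9]
  linarith

lemma log_norm_Gamma_sub_gammaMainTerm_isBigO (b : ℝ) {β : ℝ} (hβ : 0 < β) :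
    (fun z : ℝ × ℝ => Real.log ‖Complex.Gamma (b + β * (z.1 + z.2 * Complex.I))‖
      - gammaMainTerm b β z) =O[atTop ×ˢ ⊤]
    (fun z : ℝ × ℝ => 1 + Real.log (1 + z.2 ^ 2 / z.1 ^ 2)) := by
  obtain ⟨C, hC⟩ := exists_eventually_abs_log_Gamma_add_sub_le b
  have hC' := (tendsto_id.const_mul_atTop hβ).eventually hC
  set D := |b - 1 / 2| * |Real.log β|
  refine IsBigO.of_bound (C + D + 2 * |b| + 2) ?_
  have hev := (hC'.and ((eventually_gt_atTop 0).and (eventually_ge_atTop (2 * |b| / β)))).prod_inl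
    (⊤ : Filter ℝ)
  filter_upwards [hev]
  rintro ⟨c, t⟩ ⟨h1, hc, hc2⟩
  simp only [id] at h1 hc hc2
  have hC0 : 0 ≤ C := (abs_nonneg _).trans h1
  have hb := abs_nonneg b
  have hb1 := neg_abs_le b
  have hb2 := le_abs_self b
  rw [div_le_iff₀ hβ] at hc2
  have hbc : 0 < β * c := by positivity
  have hx : β * c / 2 ≤ β * c + b := by linarith
  have hx0 : 0 < β * c + b := by linarith
  set l := Real.log (1 + t ^ 2 / c ^ 2) with hl
  have hl0 : 0 ≤ l := log_one_add_sq_div_nonneg c t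
  have hphase : |gammaPhase (β * c + b) (β * t) - β * gammaPhase c t| ≤ |b| * (2 + l) := by
    rw [← gammaPhase_smul hβ]
    have e1 := log_one_add_sq_div_le hc hβ (by linarith : β * c / 2 ≤ β * c) (rfl : β * t = β * t)
    have e2 := log_one_add_sq_div_le hc hβ hx (rfl : β * t = β * t)
    have p1 := log_one_add_sq_div_nonneg (β * c) (β * t)
    have p2 := log_one_add_sq_div_nonneg (β * c + b) (β * t)
    rcases le_total 0 b with h0 | h0
    · rw [abs_of_nonneg h0]
      have := gammaPhase_sub_mem hbc (by linarith : β * c ≤ β * c + b) (β * t)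
      rw [add_sub_cancel_left] at this
      rw [abs_le]
      constructor <;> nlinarith
    · rw [abs_of_nonpos h0]
      have := gammaPhase_sub_mem hx0 (by linarith : β * c + b ≤ β * c) (β * t)
      rw [show β * c - (β * c + b) = -b by ring] at this
      rw [abs_le]
      constructor <;> nlinarith
  have hG := abs_log_norm_Gamma_sub_le hx0 (β * t)
  have hG' := log_one_add_sq_div_le hc hβ hx (rfl : β * t = β * t)
  have harg : (b : ℂ) + β * (c + t * Complex.I) =
      ((β * c + b : ℝ) : ℂ) + ((β * t : ℝ) : ℂ) * Complex.I := by
    push_cast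
    ring
  have hD : |(b - 1 / 2) * Real.log β| ≤ D := (abs_mul _ _).le
  have hD0 : 0 ≤ D := by positivity
  rw [Real.log_mul hβ.ne' hc.ne'] at h1
  rw [harg, Real.norm_eq_abs, Real.norm_of_nonneg (by linarith)]
  simp only [gammaMainTerm]
  rw [abs_le] at h1 hphase hG hD ⊢
  rw [← hl] at hG'
  have q1 := mul_nonneg hb hl0
  have q2 := mul_nonneg hC0 hl0
  have q3 := mul_nonneg hD0 hl0
  constructor
  · linarith [h1.1, hphase.2, hG.1, hD.1]
  · linarith [h1.2, hphase.1, hG.2, hD.2]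

lemma eventually_prod_Gamma_ne_zero {n : ℕ} {b β : ℕ → ℝ} (hβ : ∀ j < n, 0 < β j) :
    ∀ᶠ c : ℝ in atTop, ∀ j ∈ Finset.range n, ∀ t : ℝ,
      Complex.Gamma (b j + β j * (c + t * Complex.I)) ≠ 0 := by
  rw [Filter.eventually_all_finset]
  intro j hj
  have hβj := hβ j (Finset.mem_range.1 hj)
  filter_upwards [eventually_gt_atTop (-(b j) / β j)] with c hc t
  rw [div_lt_iff₀ hβj] at hc
  refine Complex.Gamma_ne_zero_of_re_pos ?_
  simp
  linarith

lemma exists_norm_foxKernelM_le {m p : ℕ} {a α b β : ℕ → ℝ}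
    (hα : ∀ i < p, 0 < α i) (hβ : ∀ j < m, 0 < β j) {Δ μ : ℝ}
    (hΔ : Δ = ∑ j ∈ Finset.range m, β j - ∑ i ∈ Finset.range p, α i)
    (hμ : μ = ∑ j ∈ Finset.range m, b j - ∑ i ∈ Finset.range p, a i + ((p : ℝ) - m) / 2) :
    ∃ C, ∀ᶠ c : ℝ in atTop, ∀ t : ℝ, ‖foxKernelM m p a α b β (c + t * Complex.I)‖ ≤
      Real.exp (Δ * (c * Real.log c - c) + c * (∑ j ∈ Finset.range m, β j * Real.log (β j) -
        ∑ i ∈ Finset.range p, α i * Real.log (α i)) + μ * Real.log c - Δ * gammaPhase c t +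
        C * (1 + Real.log (1 + t ^ 2 / c ^ 2))) := by
  have h1 := IsBigO.sum (s := Finset.range m) fun j hj =>
    log_norm_Gamma_sub_gammaMainTerm_isBigO (b j) (hβ j (Finset.mem_range.1 hj))
  have h2 := IsBigO.sum (s := Finset.range p) fun i hi =>
    log_norm_Gamma_sub_gammaMainTerm_isBigO (a i) (hα i (Finset.mem_range.1 hi))
  obtain ⟨C, hC⟩ := (h1.sub h2).bound
  rw [Filter.Eventually, Filter.mem_prod_top] at hC
  refine ⟨C, ?_⟩
  filter_upwards [hC, eventually_prod_Gamma_ne_zero (b := b) hβ,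
    eventually_prod_Gamma_ne_zero (b := a) hα] with c h n1 n2 t
  have h := h t
  simp only [Finset.sum_apply, Finset.sum_sub_distrib] at h
  have hl : 0 ≤ 1 + Real.log (1 + t ^ 2 / c ^ 2) := by
    have := log_one_add_sq_div_nonneg c t
    linarith
  rw [Real.norm_of_nonneg hl] at h
  have hlog : Real.log ‖foxKernelM m p a α b β (c + t * Complex.I)‖ =
      ∑ j ∈ Finset.range m, Real.log ‖Complex.Gamma (b j + β j * (c + t * Complex.I))‖ -
      ∑ i ∈ Finset.range p, Real.log ‖Complex.Gamma (a i + α i * (c + t * Complex.I))‖ := by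
    rw [foxKernelM, norm_div, norm_prod, norm_prod, Real.log_div, Real.log_prod, Real.log_prod]
    · exact fun i hi => norm_ne_zero_iff.2 (n2 i hi t)
    · exact fun j hj => norm_ne_zero_iff.2 (n1 j hj t)
    · exact Finset.prod_ne_zero_iff.2 fun j hj => norm_ne_zero_iff.2 (n1 j hj t)
    · exact Finset.prod_ne_zero_iff.2 fun j hj => norm_ne_zero_iff.2 (n2 j hj t)
  have hsum : ∑ j ∈ Finset.range m, gammaMainTerm (b j) (β j) (c, t) -
      ∑ i ∈ Finset.range p, gammaMainTerm (a i) (α i) (c, t) =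
      Δ * (c * Real.log c - c) + c * (∑ j ∈ Finset.range m, β j * Real.log (β j) -
        ∑ i ∈ Finset.range p, α i * Real.log (α i)) + μ * Real.log c - Δ * gammaPhase c t := by
    simp only [gammaMainTerm, Finset.sum_add_distrib, Finset.sum_sub_distrib, ← Finset.sum_mul,
      ← Finset.mul_sum, Finset.sum_const, Finset.card_range, nsmul_eq_mul, hΔ, hμ]
    ring
  refine (Real.le_exp_log _).trans (Real.exp_le_exp.2 ?_)
  have h3 := (le_abs_self _).trans h
  rw [hlog]
  linarith

lemma exists_mul_log_one_add_abs_sub_le (C : ℝ) {ε : ℝ} (hε : 0 < ε) :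
    ∃ M, ∀ t : ℝ, C * Real.log (1 + |t|) - ε * |t| ≤ M - Real.log (1 + t ^ 2) := by
  set K := |C| + 2
  have hK : 0 < K := by positivity
  refine ⟨ε - K - K * Real.log (ε / K), fun t => ?_⟩
  have ht := abs_nonneg t
  have hl : 0 ≤ Real.log (1 + |t|) := Real.log_nonneg (by linarith)
  have h1 : Real.log (1 + t ^ 2) ≤ 2 * Real.log (1 + |t|) := by
    rw [← sq_abs, ← Real.log_rpow (by positivity), Real.rpow_two]
    gcongr
    nlinarith
  have h2 := Real.log_le_sub_one_of_pos (x := ε / K * (1 + |t|)) (by positivity)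
  rw [Real.log_mul (by positivity) (by positivity)] at h2
  have h3 := mul_le_mul_of_nonneg_left h2 hK.le
  have h4 : K * (ε / K * (1 + |t|) - 1) = ε * (1 + |t|) - K := by field_simp
  have h5 : C * Real.log (1 + |t|) ≤ |C| * Real.log (1 + |t|) := by
    gcongr
    exact le_abs_self C
  rw [h4] at h3
  have h6 : K * Real.log (1 + |t|) = |C| * Real.log (1 + |t|) + 2 * Real.log (1 + |t|) := by
    simp only [K]
    ring
  linarith

lemma exp_sub_log_one_add_sq (M t : ℝ) :
    Real.exp (M - Real.log (1 + t ^ 2)) = Real.exp M * (1 + t ^ 2)⁻¹ := by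
  rw [Real.exp_sub, Real.exp_log (by positivity), div_eq_mul_inv]

lemma abs_div_sqrt_sub_one_le_gammaPhase {c : ℝ} (hc : 1 ≤ c) (t : ℝ) :
    (|t / √c| - 1) / 2 ≤ gammaPhase c t := by
  refine le_trans ?_ (sq_div_le_gammaPhase (by linarith) t)
  have hs : 1 ≤ √c := Real.one_le_sqrt.2 hc
  have hs0 : 0 < √c := by linarith
  have hcs : c = √c ^ 2 := (Real.sq_sqrt (by linarith)).symm
  obtain ⟨v, hv⟩ : ∃ v, v = |t / √c| := ⟨_, rfl⟩
  have hv0 : 0 ≤ v := hv ▸ abs_nonneg _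
  have ht : |t| = √c * v := by
    rw [hv, abs_div, abs_of_pos hs0]
    field_simp
  rw [← hv, ← sq_abs t, ht, hcs, Real.sqrt_sq hs0.le, div_le_div_iff₀ (by norm_num) (by positivity)]
  set s := √c
  nlinarith [mul_nonneg (mul_nonneg hs0.le (by linarith : 0 ≤ s - 1)) (sq_nonneg (v - 1 / 2)),
    mul_nonneg hs0.le (by linarith : 0 ≤ s - 1)]

lemma exists_exp_sub_gammaPhase_le (C : ℝ) {Δ : ℝ} (hΔ : 0 < Δ) : ∃ M, ∀ c : ℝ, 1 ≤ c → ∀ t : ℝ,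
    Real.exp (C * (1 + Real.log (1 + t ^ 2 / c ^ 2)) - Δ * gammaPhase c t) ≤
      Real.exp M * (1 + (t / √c) ^ 2)⁻¹ := by
  obtain ⟨M, hM⟩ := exists_mul_log_one_add_abs_sub_le (2 * |C|) (half_pos hΔ)
  refine ⟨M + |C| + Δ / 2, fun c hc t => ?_⟩
  rw [← exp_sub_log_one_add_sq, Real.exp_le_exp]
  have h1 := hM (t / √c)
  have h2 := mul_le_mul_of_nonneg_left (abs_div_sqrt_sub_one_le_gammaPhase hc t) hΔ.le
  have hl : 0 ≤ Real.log (1 + t ^ 2 / c ^ 2) := log_one_add_sq_div_nonneg c t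
  have h3 : Real.log (1 + t ^ 2 / c ^ 2) ≤ 2 * Real.log (1 + |t / √c|) := by
    have h4 : t ^ 2 / c ^ 2 ≤ |t / √c| ^ 2 := by
      rw [sq_abs, div_pow, Real.sq_sqrt (by linarith)]
      gcongr
      nlinarith
    rw [← Real.log_rpow (by positivity), Real.rpow_two]
    gcongr
    nlinarith [abs_nonneg (t / √c)]
  have h5 : C * (1 + Real.log (1 + t ^ 2 / c ^ 2)) ≤ |C| * (1 + 2 * Real.log (1 + |t / √c|)) := by
    calc _ ≤ |C| * (1 + Real.log (1 + t ^ 2 / c ^ 2)) := by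
          gcongr
          exact le_abs_self C
      _ ≤ _ := by gcongr
  linarith

/-- On the strip `A ≤ re s ≤ B`, `f` is bounded by a polynomial in `|im s|` times
`exp (κ |im s|)`. -/
def IsStripBounded (A B κ : ℝ) (f : ℂ → ℂ) : Prop :=
  ∃ C K : ℝ, ∀ σ ∈ Set.Icc A B, ∀ t : ℝ,
    ‖f (σ + t * Complex.I)‖ ≤ Real.exp (C + K * Real.log (1 + |t|) + κ * |t|)

lemma IsStripBounded.mul {A B κ κ' : ℝ} {f g : ℂ → ℂ} (hf : IsStripBounded A B κ f)
    (hg : IsStripBounded A B κ' g) : IsStripBounded A B (κ + κ') (fun s => f s * g s) := by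
  obtain ⟨C, K, h⟩ := hf
  obtain ⟨C', K', h'⟩ := hg
  refine ⟨C + C', K + K', fun σ hσ t => ?_⟩
  rw [norm_mul]
  calc _ ≤ Real.exp (C + K * Real.log (1 + |t|) + κ * |t|) *
        Real.exp (C' + K' * Real.log (1 + |t|) + κ' * |t|) := by
        gcongr
        exacts [h σ hσ t, h' σ hσ t]
    _ = _ := by
      rw [← Real.exp_add]
      ring_nf

lemma IsStripBounded.prod {A B : ℝ} {n : ℕ} {κ : ℕ → ℝ} {f : ℕ → ℂ → ℂ}
    (h : ∀ j < n, IsStripBounded A B (κ j) (f j)) :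
    IsStripBounded A B (∑ j ∈ Finset.range n, κ j) (fun s => ∏ j ∈ Finset.range n, f j s) := by
  induction n with
  | zero => exact ⟨0, 0, fun σ _ t => by simp⟩
  | succ n ih =>
    simp only [Finset.prod_range_succ, Finset.sum_range_succ]
    exact (ih fun j hj => h j (by omega)).mul (h n (by omega))

lemma exists_abs_log_norm_Gamma_add_le {A b β : ℝ} (B : ℝ) (hβ : 0 < β) (hA : 0 < b + β * A) :
    ∃ C K : ℝ, ∀ σ ∈ Set.Icc A B, ∀ t : ℝ,
      |Real.log ‖Complex.Gamma (b + β * (σ + t * Complex.I))‖ + Real.pi / 2 * (β * |t|)| ≤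
        C + K * Real.log (1 + |t|) := by
  set x₀ := b + β * A
  set x₁ := b + β * B
  have hc : ContinuousOn (fun x => Real.log (Real.Gamma x)) (Set.Icc x₀ x₁) := by
    intro x hx
    have hx0 : 0 < x := hA.trans_le hx.1
    exact (ContinuousAt.log (Real.differentiableAt_Gamma fun m => by
        have : (0 : ℝ) ≤ m := m.cast_nonneg
        linarith).continuousAt (Real.Gamma_pos_of_pos hx0).ne').continuousWithinAt
  obtain ⟨C₁, hC₁⟩ := isCompact_Icc.exists_bound_of_continuousOn hc
  set L := Real.log (1 + β / x₀)
  refine ⟨C₁ + x₁ + (1 + x₁) * L, 1 + x₁, fun σ hσ t => ?_⟩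
  obtain ⟨x, hx⟩ : ∃ x, x = b + β * σ := ⟨_, rfl⟩
  have hxm : x ∈ Set.Icc x₀ x₁ := by
    rw [hx]
    have := hσ.1
    have := hσ.2
    constructor <;> simp only [x₀, x₁] <;> gcongr
  have hx0 : 0 < x := hA.trans_le hxm.1
  have harg : (b : ℂ) + β * (σ + t * Complex.I) = (x : ℂ) + ((β * t : ℝ) : ℂ) * Complex.I := by
    rw [hx]
    push_cast
    ring
  have hE : Real.log (1 + (β * t) ^ 2 / x ^ 2) ≤ 2 * (L + Real.log (1 + |t|)) := by
    have ht := abs_nonneg t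
    rw [← Real.log_mul (by positivity) (by positivity), ← Real.log_rpow (by positivity),
      Real.rpow_two]
    refine Real.log_le_log (by positivity) ?_
    have h1 : (β * t) ^ 2 / x ^ 2 ≤ (β / x₀ * |t|) ^ 2 := by
      calc (β * t) ^ 2 / x ^ 2 ≤ (β * t) ^ 2 / x₀ ^ 2 := by
            gcongr
            exact hxm.1
        _ = _ := by
          rw [mul_pow, mul_pow, sq_abs, div_pow]
          ring
    have hq : 0 ≤ β / x₀ := by positivity
    nlinarith [mul_nonneg hq ht, mul_nonneg (mul_nonneg hq ht) (mul_nonneg hq ht)]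
  have hE0 := log_one_add_sq_div_nonneg x (β * t)
  have h1 := abs_log_norm_Gamma_sub_le hx0 (β * t)
  have h2 := hC₁ x hxm
  have h3 := pi_half_mul_abs_sub_le_gammaPhase hx0 (β * t)
  have h4 := gammaPhase_le_pi_half_mul_abs hx0 (β * t)
  have h5 : x * Real.log (1 + (β * t) ^ 2 / x ^ 2) ≤ x₁ * (2 * (L + Real.log (1 + |t|))) := by
    have := hx0.trans_le hxm.2
    exact mul_le_mul hxm.2 hE hE0 this.le
  have h6 := hxm.2
  rw [abs_mul, abs_of_pos hβ] at h3 h4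
  rw [harg]
  rw [Real.norm_eq_abs] at h2
  rw [abs_le] at h1 h2 ⊢
  constructor <;> linarith [h1.1, h1.2, h2.1, h2.2]

lemma isStripBounded_Gamma {A b β : ℝ} (B : ℝ) (hβ : 0 < β) (hA : 0 < b + β * A) :
    IsStripBounded A B (-(Real.pi / 2 * β)) (fun s => Complex.Gamma (b + β * s)) := by
  obtain ⟨C, K, h⟩ := exists_abs_log_norm_Gamma_add_le B hβ hA
  refine ⟨C, K, fun σ hσ t => (Real.le_exp_log _).trans (Real.exp_le_exp.2 ?_)⟩
  linarith [(abs_le.1 (h σ hσ t)).2]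

lemma isStripBounded_linear (A B a α : ℝ) :
    IsStripBounded A B 0 (fun s => (a : ℂ) + α * s) := by
  set M := |a| + |α| * (|A| + |B| + 1) + 1
  have hM : 0 < M := by positivity
  refine ⟨Real.log M, 1, fun σ hσ t => ?_⟩
  have ht : 0 < 1 + |t| := by positivity
  rw [one_mul, zero_mul, add_zero, Real.exp_add, Real.exp_log hM, Real.exp_log ht]
  have h1 : |σ| ≤ |A| + |B| := by
    have := hσ.1
    have := hσ.2
    rw [abs_le]
    constructor <;> linarith [neg_abs_le A, le_abs_self B, abs_nonneg A, abs_nonneg B]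
  have h2 : ‖(σ : ℂ) + t * Complex.I‖ ≤ |A| + |B| + |t| := by
    refine (norm_add_le _ _).trans ?_
    simp only [norm_mul, Complex.norm_real, Complex.norm_I, mul_one, Real.norm_eq_abs]
    linarith
  calc ‖(a : ℂ) + α * (σ + t * Complex.I)‖ ≤ |a| + |α| * (|A| + |B| + |t|) := by
        refine (norm_add_le _ _).trans ?_
        rw [norm_mul, Complex.norm_real, Complex.norm_real, Real.norm_eq_abs, Real.norm_eq_abs]
        gcongr
    _ ≤ M * (1 + |t|) := by
        have e : M * (1 + |t|) = |a| + |α| * (|A| + |B| + |t|) + (|α| + 1 + |a| * |t| +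
          |α| * (|A| + |B|) * |t| + |t|) := by
          simp only [M]
          ring
        rw [e]
        exact le_add_of_nonneg_right (by positivity)

lemma isStripBounded_inv_Gamma (A B a : ℝ) {α : ℝ} (hα : 0 < α) :
    IsStripBounded A B (Real.pi / 2 * α) (fun s => (Complex.Gamma (a + α * s))⁻¹) := by
  have key : ∀ N : ℕ, ∀ a : ℝ, 0 < a + N + α * A →
      IsStripBounded A B (Real.pi / 2 * α) (fun s => (Complex.Gamma (a + α * s))⁻¹) := by
    intro N
    induction N with
    | zero =>
      intro a ha
      obtain ⟨C, K, h⟩ := exists_abs_log_norm_Gamma_add_le B hα (by simpa using ha)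
      refine ⟨C, K, fun σ hσ t => (Real.le_exp_log _).trans (Real.exp_le_exp.2 ?_)⟩
      rw [norm_inv, Real.log_inv]
      linarith [(abs_le.1 (h σ hσ t)).1]
    | succ N ih =>
      intro a ha
      have h := (isStripBounded_linear A B a α).mul (ih (a + 1) (by push_cast at ha; linarith))
      rw [zero_add] at h
      convert h using 2 with s
      rw [Complex.one_div_Gamma_eq_self_mul_one_div_Gamma_add_one]
      push_cast
      ring_nf
  obtain ⟨N, hN⟩ := exists_nat_gt (-(a + α * A))
  exact key N a (by linarith)

lemma isStripBounded_foxKernelM {m p : ℕ} {a α b β : ℕ → ℝ} {A : ℝ} (B : ℝ)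
    (hα : ∀ i < p, 0 < α i) (hβ : ∀ j < m, 0 < β j) (hA : ∀ j < m, 0 < b j + β j * A) :
    IsStripBounded A B (-(Real.pi / 2 * (∑ j ∈ Finset.range m, β j - ∑ i ∈ Finset.range p, α i)))
      (foxKernelM m p a α b β) := by
  have h := (IsStripBounded.prod fun j hj => isStripBounded_Gamma B (hβ j hj) (hA j hj)).mul
    (IsStripBounded.prod fun i hi => isStripBounded_inv_Gamma A B (a i) (hα i hi))
  rw [Finset.sum_neg_distrib, ← Finset.mul_sum, ← Finset.mul_sum] at h
  convert h using 1
  · ring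
  · funext s
    rw [foxKernelM, div_eq_mul_inv, Finset.prod_inv_distrib]

/-- Vertical contours may be shifted across a strip where the integrand is holomorphic and
decays like `(1 + t²)⁻¹`. -/
lemma integral_vertical_eq_of_norm_le {f : ℂ → ℂ} {A B M : ℝ} (hAB : A ≤ B)
    (hd : ∀ s : ℂ, A ≤ s.re → s.re ≤ B → DifferentiableAt ℂ f s)
    (hM : ∀ σ ∈ Set.Icc A B, ∀ t : ℝ, ‖f (σ + t * Complex.I)‖ ≤ M * (1 + t ^ 2)⁻¹) :
    ∫ t : ℝ, f (A + t * Complex.I) = ∫ t : ℝ, f (B + t * Complex.I) := by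
  have hint : ∀ σ ∈ Set.Icc A B, Integrable fun t : ℝ => f (σ + t * Complex.I) := by
    intro σ hσ
    refine (integrable_inv_one_add_sq.const_mul M).mono' ?_ (Eventually.of_forall (hM σ hσ))
    refine Continuous.aestronglyMeasurable (continuous_iff_continuousAt.2 fun t => ?_)
    have h1 : ContinuousAt f (σ + t * Complex.I) :=
      (hd _ (by simpa using hσ.1) (by simpa using hσ.2)).continuousAt
    exact ContinuousAt.comp (f := fun t : ℝ => (σ : ℂ) + t * Complex.I) h1
      (by fun_prop : Continuous fun t : ℝ => (σ : ℂ) + t * Complex.I).continuousAt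
  have hrect : ∀ T : ℝ,
      (((∫ x : ℝ in A..B, f (x + (-T : ℝ) * Complex.I)) - ∫ x : ℝ in A..B, f (x + T * Complex.I)) +
        Complex.I • ∫ y : ℝ in (-T)..T, f (B + y * Complex.I)) -
        Complex.I • ∫ y : ℝ in (-T)..T, f (A + y * Complex.I) = 0 := by
    intro T
    have h := Complex.integral_boundary_rect_eq_zero_of_differentiableOn f ⟨A, -T⟩ ⟨B, T⟩ ?_
    · simpa using h
    · intro s hs
      rw [Complex.mem_reProdIm, Set.uIcc_of_le hAB] at hs
      exact (hd s hs.1.1 hs.1.2).differentiableWithinAt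
  have hdecay : Tendsto (fun T : ℝ => M * (1 + T ^ 2)⁻¹ * |B - A|) atTop (nhds 0) := by
    have h1 : Tendsto (fun T : ℝ => 1 + T ^ 2) atTop atTop :=
      tendsto_atTop_add_const_left _ _ (tendsto_pow_atTop two_ne_zero)
    simpa using (h1.inv_tendsto_atTop.const_mul M).mul_const |B - A|
  have hhor : ∀ T : ℝ, ‖∫ x : ℝ in A..B, f (x + T * Complex.I)‖ ≤ M * (1 + T ^ 2)⁻¹ * |B - A| := by
    intro T
    refine intervalIntegral.norm_integral_le_of_norm_le_const fun x hx => ?_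
    rw [Set.uIoc_of_le hAB] at hx
    exact hM x ⟨hx.1.le, hx.2⟩ T
  have t1 : Tendsto (fun T : ℝ => ∫ x : ℝ in A..B, f (x + T * Complex.I)) atTop (nhds 0) :=
    squeeze_zero_norm hhor hdecay
  have t2 : Tendsto (fun T : ℝ => ∫ x : ℝ in A..B, f (x + (-T : ℝ) * Complex.I)) atTop (nhds 0) :=
    squeeze_zero_norm (fun T => by simpa using hhor (-T)) hdecay
  have t3 := intervalIntegral_tendsto_integral (hint B (Set.right_mem_Icc.2 hAB))
    tendsto_neg_atTop_atBot tendsto_id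
  have t4 := intervalIntegral_tendsto_integral (hint A (Set.left_mem_Icc.2 hAB))
    tendsto_neg_atTop_atBot tendsto_id
  have t5 := ((t2.sub t1).add (t3.const_smul Complex.I)).sub (t4.const_smul Complex.I)
  simp only [id] at t5
  have h0 := tendsto_nhds_unique (t5.congr hrect) tendsto_const_nhds
  rw [sub_zero, zero_add, sub_eq_zero, smul_eq_mul, smul_eq_mul] at h0
  exact (mul_left_cancel₀ Complex.I_ne_zero h0).symm

lemma differentiableAt_foxKernelM {m p : ℕ} {a α b β : ℕ → ℝ} {s : ℂ}
    (hs : ∀ j < m, 0 < b j + β j * s.re) :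
    DifferentiableAt ℂ (foxKernelM m p a α b β) s := by
  have e : foxKernelM m p a α b β = fun s => (∏ j ∈ Finset.range m, Complex.Gamma (b j + β j * s)) *
      ∏ i ∈ Finset.range p, (Complex.Gamma (a i + α i * s))⁻¹ := by
    funext s
    rw [foxKernelM, div_eq_mul_inv, Finset.prod_inv_distrib]
  rw [e]
  refine DifferentiableAt.mul (DifferentiableAt.fun_finsetProd fun j hj => ?_)
    (DifferentiableAt.fun_finsetProd fun i _ => ?_)
  · have h1 : DifferentiableAt ℂ Complex.Gamma (b j + β j * s) := by
      refine Complex.differentiableAt_Gamma _ fun n hn => ?_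
      have h2 := congrArg Complex.re hn
      have h3 := hs j (Finset.mem_range.1 hj)
      have h4 : (0 : ℝ) ≤ n := n.cast_nonneg
      simp at h2
      linarith
    exact DifferentiableAt.comp s h1 (by fun_prop)
  · exact DifferentiableAt.comp (g := fun s => (Complex.Gamma s)⁻¹) s
      (Complex.differentiable_one_div_Gamma _) (by fun_prop)

lemma foxHposM_eq_of_le {m p : ℕ} {a α b β : ℕ → ℝ}
    (hα : ∀ i < p, 0 < α i) (hβ : ∀ j < m, 0 < β j) {γ c : ℝ} (hγ : ∀ j < m, -(b j) / β j < γ)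
    (hΔ : 0 < ∑ j ∈ Finset.range m, β j - ∑ i ∈ Finset.range p, α i) (hc : γ ≤ c) (x : ℝ) :
    foxHposM m p a α b β γ x = foxHposM m p a α b β c x := by
  have hpos : ∀ σ, γ ≤ σ → ∀ j < m, 0 < b j + β j * σ := by
    intro σ hσ j hj
    have h := (hγ j hj).trans_le hσ
    rw [div_lt_iff₀ (hβ j hj)] at h
    linarith
  obtain ⟨C, K, h⟩ := isStripBounded_foxKernelM (a := a) c hα hβ (hpos γ le_rfl)
  obtain ⟨M, hM⟩ := exists_mul_log_one_add_abs_sub_le K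
    (mul_pos (half_pos Real.pi_pos) hΔ)
  set D := (|γ| + |c|) * |Real.log x|
  unfold foxHposM
  congr 1
  refine integral_vertical_eq_of_norm_le (M := Real.exp (C + M + D))
    (f := fun s => foxKernelM m p a α b β s * Complex.exp (-s * (Real.log x : ℂ))) hc
    (fun s h1 _ => (differentiableAt_foxKernelM (hpos _ h1)).mul (by fun_prop)) ?_
  intro σ hσ t
  have h1 := h σ hσ t
  have h2 := hM t
  have h3 : -σ * Real.log x ≤ D := by
    refine (le_abs_self _).trans ?_
    rw [abs_mul, abs_neg]
    refine mul_le_mul_of_nonneg_right ?_ (abs_nonneg _)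
    have := hσ.1
    have := hσ.2
    rw [abs_le]
    constructor <;> linarith [neg_abs_le γ, le_abs_self c, abs_nonneg γ, abs_nonneg c]
  rw [← exp_sub_log_one_add_sq, norm_mul, Complex.norm_exp]
  have hre : (-((σ : ℂ) + t * Complex.I) * (Real.log x : ℂ)).re = -σ * Real.log x := by simp
  rw [hre]
  calc _ ≤ Real.exp (C + K * Real.log (1 + |t|) + -(Real.pi / 2 *
        (∑ j ∈ Finset.range m, β j - ∑ i ∈ Finset.range p, α i)) * |t|) *
          Real.exp (-σ * Real.log x) := by gcongr
    _ ≤ _ := by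
      rw [← Real.exp_add, Real.exp_le_exp]
      linarith

lemma exists_norm_foxHposM_le {m p : ℕ} {a α b β : ℕ → ℝ}
    (hα : ∀ i < p, 0 < α i) (hβ : ∀ j < m, 0 < β j) {Δ μ : ℝ}
    (hΔ : Δ = ∑ j ∈ Finset.range m, β j - ∑ i ∈ Finset.range p, α i) (hΔpos : 0 < Δ)
    (hμ : μ = ∑ j ∈ Finset.range m, b j - ∑ i ∈ Finset.range p, a i + ((p : ℝ) - m) / 2) :
    ∃ K, ∀ᶠ c : ℝ in atTop, ∀ x : ℝ, Real.log x = Δ * Real.log c +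
        (∑ j ∈ Finset.range m, β j * Real.log (β j) - ∑ i ∈ Finset.range p, α i * Real.log (α i)) →
      ‖foxHposM m p a α b β c x‖ ≤ K * (c ^ (μ + 1 / 2) * Real.exp (-Δ * c)) := by
  obtain ⟨C, hC⟩ := exists_norm_foxKernelM_le (a := a) (b := b) hα hβ hΔ hμ
  obtain ⟨M, hM⟩ := exists_exp_sub_gammaPhase_le C hΔpos
  refine ⟨1 / (2 * Real.pi) * (Real.exp M * Real.pi), ?_⟩
  filter_upwards [hC, eventually_ge_atTop 1] with c h hc x hx
  have hc0 : 0 < c := by linarith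
  have hs : √c ≠ 0 := (Real.sqrt_pos.2 hc0).ne'
  set E := Real.exp (μ * Real.log c - Δ * c)
  have hbound : ∀ t : ℝ, ‖foxKernelM m p a α b β ((c : ℂ) + (t : ℂ) * Complex.I) *
      Complex.exp (-((c : ℂ) + (t : ℂ) * Complex.I) * (Real.log x : ℂ))‖ ≤
      E * (Real.exp M * (1 + (t / √c) ^ 2)⁻¹) := by
    intro t
    have hre : (-((c : ℂ) + t * Complex.I) * (Real.log x : ℂ)).re = -c * Real.log x := by simp
    rw [norm_mul, Complex.norm_exp, hre]
    refine (mul_le_mul_of_nonneg_right (h t) (Real.exp_pos _).le).trans ?_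
    refine le_trans (le_of_eq ?_) (mul_le_mul_of_nonneg_left (hM c hc t) (Real.exp_pos _).le)
    rw [← Real.exp_add, ← Real.exp_add, hx]
    ring_nf
  have hint : Integrable fun t : ℝ => E * (Real.exp M * (1 + (t / √c) ^ 2)⁻¹) :=
    ((integrable_inv_one_add_sq.comp_div hs).const_mul _).const_mul _
  have hI := norm_integral_le_of_norm_le hint (Eventually.of_forall hbound)
  rw [MeasureTheory.integral_const_mul, MeasureTheory.integral_const_mul,
    Measure.integral_comp_div (fun t : ℝ => (1 + t ^ 2)⁻¹), integral_univ_inv_one_add_sq,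
    abs_of_nonneg (Real.sqrt_nonneg c), smul_eq_mul] at hI
  have hE : E * √c = c ^ (μ + 1 / 2) * Real.exp (-Δ * c) := by
    rw [Real.rpow_add hc0, ← Real.sqrt_eq_rpow, Real.rpow_def_of_pos hc0]
    simp only [E]
    rw [sub_eq_add_neg, Real.exp_add]
    ring_nf
  have hpre : ‖(1 / (2 * (Real.pi : ℂ)))‖ = 1 / (2 * Real.pi) := by
    simp [abs_of_pos Real.pi_pos]
  rw [foxHposM, norm_mul, hpre, ← hE, mul_assoc]
  refine mul_le_mul_of_nonneg_left (hI.trans (le_of_eq ?_)) (by positivity)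
  ring

/-- exponential decay of Fox-H functions of type `(m,0;p,m)` at `+∞`:
`H(x) = O(x^{(μ+1/2)/Δ} exp(-Δ δ^{-1/Δ} x^{1/Δ}))` as `x → +∞`. -/
theorem foxH_asymptotics_infinity
    (m p : ℕ) (hm : 1 ≤ m)
    (a α b β : ℕ → ℝ)
    (hα : ∀ i < p, 0 < α i) (hβ : ∀ j < m, 0 < β j)
    (hb : ∀ j < m, 0 < b j + β j) (ha : ∀ i < p, 0 < a i + α i)
    (hbsimple : ∀ j < m, ∀ j' < m, ∀ l l' : ℕ,
      -(b j + l) / β j = -(b j' + l') / β j' → j = j' ∧ l = l')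
    (γ : ℝ) (hγ : ∀ j < m, -(b j) / β j < γ)
    (Δ μ δ : ℝ)
    (hΔ : Δ = ∑ j ∈ Finset.range m, β j - ∑ i ∈ Finset.range p, α i)
    (hΔpos : 0 < Δ)
    (hμ : μ = ∑ j ∈ Finset.range m, b j - ∑ i ∈ Finset.range p, a i + ((p : ℝ) - m) / 2)
    (hδ : δ = (∏ j ∈ Finset.range m, (β j) ^ (β j)) *
      ∏ i ∈ Finset.range p, (α i) ^ (-(α i))) :
    (fun x : ℝ => foxHposM m p a α b β γ x) =O[Filter.atTop]
      fun x : ℝ => x ^ ((μ + 1 / 2) / Δ) * Real.exp (-Δ * δ ^ (-(1 / Δ)) * x ^ (1 / Δ)) := by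
  have hlogδ : Real.log δ =
      ∑ j ∈ Finset.range m, β j * Real.log (β j) - ∑ i ∈ Finset.range p, α i * Real.log (α i) := by
    rw [hδ, Real.log_mul, Real.log_prod, Real.log_prod, sub_eq_add_neg, ← Finset.sum_neg_distrib]
    · congr 1
      · exact Finset.sum_congr rfl fun j hj => Real.log_rpow (hβ j (Finset.mem_range.1 hj)) _
      · refine Finset.sum_congr rfl fun i hi => ?_
        rw [Real.log_rpow (hα i (Finset.mem_range.1 hi)), neg_mul]
    · exact fun i hi => (Real.rpow_pos_of_pos (hα i (Finset.mem_range.1 hi)) _).ne'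
    · exact fun j hj => (Real.rpow_pos_of_pos (hβ j (Finset.mem_range.1 hj)) _).ne'
    · exact (Finset.prod_pos fun j hj => Real.rpow_pos_of_pos (hβ j (Finset.mem_range.1 hj)) _).ne'
    · exact (Finset.prod_pos fun i hi => Real.rpow_pos_of_pos (hα i (Finset.mem_range.1 hi)) _).ne'
  have hδpos : 0 < δ := by
    rw [hδ]
    exact mul_pos
      (Finset.prod_pos fun j hj => Real.rpow_pos_of_pos (hβ j (Finset.mem_range.1 hj)) _)
      (Finset.prod_pos fun i hi => Real.rpow_pos_of_pos (hα i (Finset.mem_range.1 hi)) _)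
  obtain ⟨K, hK⟩ := exists_norm_foxHposM_le (a := a) (b := b) hα hβ hΔ hΔpos hμ
  have hc : Tendsto (fun x : ℝ => δ ^ (-(1 / Δ)) * x ^ (1 / Δ)) atTop atTop :=
    (tendsto_rpow_atTop (by positivity)).const_mul_atTop (Real.rpow_pos_of_pos hδpos _)
  refine IsBigO.of_bound (K * (δ ^ (-(1 / Δ))) ^ (μ + 1 / 2)) ?_
  filter_upwards [hc.eventually hK, hc.eventually (eventually_ge_atTop γ), eventually_gt_atTop 0]
    with x h hγx hx
  have hd := Real.rpow_pos_of_pos hδpos (-(1 / Δ))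
  have hxp := Real.rpow_pos_of_pos hx (1 / Δ)
  have hlogx : Real.log x = Δ * Real.log (δ ^ (-(1 / Δ)) * x ^ (1 / Δ)) + Real.log δ := by
    rw [Real.log_mul hd.ne' hxp.ne', Real.log_rpow hδpos, Real.log_rpow hx]
    field_simp
    ring
  have h := h x (by rw [hlogx, hlogδ])
  rw [foxHposM_eq_of_le hα hβ hγ (hΔ ▸ hΔpos) hγx]
  refine h.trans (le_of_eq ?_)
  rw [Real.norm_of_nonneg (by positivity), Real.mul_rpow hd.le hxp.le, ← Real.rpow_mul hx.le,
    one_div_mul_eq_div]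
  ring_nf
end

section
/- Let m ≥ 1 and p ≥ 0 be integers, b_j ∈ ℝ, β_j > 0 with b_j + β_j > 0 for 1 ≤ j ≤ m, a_i ∈ ℝ, α_i > 0 with a_i + α_i > 0 for 1 ≤ i ≤ p, Δ = Σ_{j=1}^m β_j − Σ_{i=1}^p α_i > 0, and suppose the poles −(b_j+l)/β_j (1 ≤ j ≤ m, l ∈ ℕ) are pairwise distinct. Let γ > max_{1≤j≤m}(−b_j/β_j) and H(x) = (1/(2π)) ∫_{t∈ℝ} [Π_{j=1}^m Γ(b_j+β_j(γ+it)) / Π_{i=1}^p Γ(a_i+α_i(γ+it))] x^{−(γ+it)} dt for x > 0. Then, setting ρ = min_{1≤j≤m}(b_j/β_j), one has ρ > −1 and H(x) = O(x^ρ) as x → 0⁺. -/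
open MeasureTheory Finset Filter Complex Real Asymptotics

lemma norm_Gamma_mul_Gamma_le {σ τ : ℝ} (hσ : 0 < σ) (hστ : σ ≤ τ) (t : ℝ) :
    ‖Complex.Gamma (σ + t * Complex.I)‖ * Real.Gamma τ ≤
      ‖Complex.Gamma (τ + t * Complex.I)‖ * Real.Gamma σ := by
  rcases hστ.eq_or_lt with rfl | hlt
  · rfl
  have hδ : 0 < τ - σ := sub_pos.2 hlt
  have h1 := Complex.Gamma_mul_Gamma_eq_betaIntegral (s := σ + t * Complex.I)
    (t := ((τ - σ : ℝ) : ℂ)) (by simpa using hσ) (by simpa using hδ)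
  have h2 := Complex.Gamma_mul_Gamma_eq_betaIntegral (s := (σ : ℂ))
    (t := ((τ - σ : ℝ) : ℂ)) (by simpa using hσ) (by simpa using hδ)
  rw [show (σ : ℂ) + t * Complex.I + ((τ - σ : ℝ) : ℂ) = τ + t * Complex.I by push_cast; ring] at h1
  rw [show (σ : ℂ) + ((τ - σ : ℝ) : ℂ) = τ by push_cast; ring] at h2
  have key : ‖Complex.betaIntegral (σ + t * Complex.I) ((τ - σ : ℝ) : ℂ)‖ ≤
      ‖Complex.betaIntegral (σ : ℂ) ((τ - σ : ℝ) : ℂ)‖ := by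
    set g : ℝ → ℝ := fun x => x ^ (σ - 1) * (1 - x) ^ (τ - σ - 1)
    have hg : ∀ x ∈ Set.Ioc (0 : ℝ) 1, ‖(x : ℂ) ^ ((σ : ℂ) - 1) *
        (1 - (x : ℂ)) ^ (((τ - σ : ℝ) : ℂ) - 1) - (g x : ℂ)‖ = 0 := by
      intro x hx
      have hx' : 0 ≤ 1 - x := by linarith [hx.2]
      simp only [g]
      rw [Complex.ofReal_mul, Complex.ofReal_cpow hx.1.le, Complex.ofReal_cpow hx']
      push_cast
      simp
    have hB : Complex.betaIntegral (σ : ℂ) ((τ - σ : ℝ) : ℂ) = ((∫ x in (0 : ℝ)..1, g x : ℝ) : ℂ) := by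
      rw [Complex.betaIntegral, ← intervalIntegral.integral_ofReal]
      refine intervalIntegral.integral_congr_ae (Filter.Eventually.of_forall fun x hx => ?_)
      rw [Set.uIoc_of_le zero_le_one] at hx
      exact sub_eq_zero.1 (norm_eq_zero.1 (hg x hx))
    have hg0 : ∀ x ∈ Set.Ioc (0 : ℝ) 1, 0 ≤ g x := fun x hx =>
      mul_nonneg (Real.rpow_nonneg hx.1.le _) (Real.rpow_nonneg (by linarith [hx.2]) _)
    have hnorm : ∀ x ∈ Set.Ioo (0 : ℝ) 1, ‖(x : ℂ) ^ ((σ : ℂ) + t * Complex.I - 1) *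
        (1 - (x : ℂ)) ^ (((τ - σ : ℝ) : ℂ) - 1)‖ = g x := by
      intro x hx
      have hx' : 0 < 1 - x := by linarith [hx.2]
      rw [norm_mul, Complex.norm_cpow_eq_rpow_re_of_pos hx.1,
        show (1 - (x : ℂ)) = ((1 - x : ℝ) : ℂ) by push_cast; rfl,
        Complex.norm_cpow_eq_rpow_re_of_pos hx']
      simp [g]
    rw [hB, Complex.norm_real, Complex.betaIntegral]
    refine (intervalIntegral.norm_integral_le_integral_norm zero_le_one).trans ?_
    refine le_trans (le_of_eq ?_) (le_abs_self _)
    rw [intervalIntegral.integral_of_le zero_le_one, intervalIntegral.integral_of_le zero_le_one,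
      integral_Ioc_eq_integral_Ioo, integral_Ioc_eq_integral_Ioo]
    exact setIntegral_congr_fun measurableSet_Ioo hnorm
  have hΓδ := Real.Gamma_pos_of_pos hδ
  have hΓσ := Real.Gamma_pos_of_pos hσ
  have hΓτ := Real.Gamma_pos_of_pos (hσ.trans hlt)
  have n1 := congrArg norm h1
  have n2 := congrArg norm h2
  simp only [norm_mul, Complex.Gamma_ofReal, Complex.norm_real, Real.norm_of_nonneg hΓδ.le,
    Real.norm_of_nonneg hΓσ.le, Real.norm_of_nonneg hΓτ.le] at n1 n2
  refine le_of_mul_le_mul_right ?_ hΓδ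
  calc _ = Real.Gamma τ * (‖Complex.Gamma (σ + t * Complex.I)‖ * Real.Gamma (τ - σ)) := by ring
    _ ≤ Real.Gamma τ * (‖Complex.Gamma (τ + t * Complex.I)‖ *
        ‖Complex.betaIntegral (σ : ℂ) ((τ - σ : ℝ) : ℂ)‖) := by rw [n1]; gcongr
    _ = ‖Complex.Gamma (τ + t * Complex.I)‖ * (Real.Gamma τ *
        ‖Complex.betaIntegral (σ : ℂ) ((τ - σ : ℝ) : ℂ)‖) := by ring
    _ = _ := by rw [← n2]; ring

lemma sq_norm_Gamma_half (t : ℝ) :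
    ‖Complex.Gamma ((1 / 2 : ℝ) + t * Complex.I)‖ ^ 2 = π / Real.cosh (π * t) := by
  have h := Complex.Gamma_mul_Gamma_one_sub ((1 / 2 : ℝ) + t * Complex.I)
  have hc : 1 - (((1 / 2 : ℝ) : ℂ) + t * Complex.I) =
      (starRingEnd ℂ) (((1 / 2 : ℝ) : ℂ) + t * Complex.I) := by
    simp only [map_add, map_mul, Complex.conj_ofReal, Complex.conj_I]
    push_cast
    ring
  have hs : Complex.sin (π * (((1 / 2 : ℝ) : ℂ) + t * Complex.I)) = (Real.cosh (π * t) : ℂ) := by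
    rw [show (π : ℂ) * (((1 / 2 : ℝ) : ℂ) + t * Complex.I) =
      ((π * t : ℝ) : ℂ) * Complex.I + π / 2 by push_cast; ring, Complex.sin_add_pi_div_two,
      Complex.cos_mul_I, Complex.ofReal_cosh]
  rw [hc, Complex.Gamma_conj, hs, Complex.mul_conj, Complex.normSq_eq_norm_sq] at h
  exact_mod_cast h

lemma norm_Gamma_half_le (t : ℝ) :
    ‖Complex.Gamma ((1 / 2 : ℝ) + t * Complex.I)‖ ≤ √(2 * π) * Real.exp (-(π / 2 * |t|)) := by
  refine abs_le_of_sq_le_sq' ?_ (by positivity) |>.2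
  rw [sq_norm_Gamma_half, mul_pow, Real.sq_sqrt (by positivity), ← Real.exp_nat_mul,
    div_le_iff₀ (Real.cosh_pos _), ← Real.cosh_abs, abs_mul, abs_of_pos Real.pi_pos, Real.cosh_eq]
  have : Real.exp (((2 : ℕ) : ℝ) * -(π / 2 * |t|)) * Real.exp (π * |t|) = 1 := by
    rw [← Real.exp_add]; norm_num; ring
  have h3 := mul_pos (Real.exp_pos (((2 : ℕ) : ℝ) * -(π / 2 * |t|))) (Real.exp_pos (-(π * |t|)))
  nlinarith [mul_pos Real.pi_pos h3]

lemma le_norm_Gamma_half (t : ℝ) :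
    Real.exp (-(π / 2 * |t|)) ≤ ‖Complex.Gamma ((1 / 2 : ℝ) + t * Complex.I)‖ := by
  refine abs_le_of_sq_le_sq' ?_ (by positivity) |>.2
  rw [sq_norm_Gamma_half, ← Real.exp_nat_mul, le_div_iff₀ (Real.cosh_pos _), ← Real.cosh_abs,
    abs_mul, abs_of_pos Real.pi_pos, Real.cosh_eq]
  have : Real.exp (((2 : ℕ) : ℝ) * -(π / 2 * |t|)) * Real.exp (π * |t|) = 1 := by
    rw [← Real.exp_add]; norm_num; ring
  have h3 : Real.exp (-(π * |t|)) ≤ Real.exp (π * |t|) := by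
    apply Real.exp_le_exp.2
    have := mul_nonneg Real.pi_pos.le (abs_nonneg t)
    linarith
  have h4 := Real.exp_pos (((2 : ℕ) : ℝ) * -(π / 2 * |t|))
  nlinarith [mul_le_mul_of_nonneg_left h3 h4.le, Real.pi_gt_three]

/-- `f` grows at most like `exp (r |Im s|)` on the closed vertical strip `σ₁ ≤ Re s ≤ σ₂`. -/
def ExpBoundOn (σ₁ σ₂ r : ℝ) (f : ℂ → ℂ) : Prop :=
  ∃ C : ℝ, ∀ s : ℂ, σ₁ ≤ s.re → s.re ≤ σ₂ → ‖f s‖ ≤ C * Real.exp (r * |s.im|)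

namespace ExpBoundOn

variable {σ₁ σ₂ r r' : ℝ} {f g : ℂ → ℂ}

lemma exists_pos (h : ExpBoundOn σ₁ σ₂ r f) : ∃ C : ℝ, 0 < C ∧
    ∀ s : ℂ, σ₁ ≤ s.re → s.re ≤ σ₂ → ‖f s‖ ≤ C * Real.exp (r * |s.im|) := by
  obtain ⟨C, hC⟩ := h
  refine ⟨max C 1, by positivity, fun s h1 h2 => (hC s h1 h2).trans ?_⟩
  gcongr
  exact le_max_left _ _

lemma mul (hf : ExpBoundOn σ₁ σ₂ r f) (hg : ExpBoundOn σ₁ σ₂ r' g) :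
    ExpBoundOn σ₁ σ₂ (r + r') (fun s => f s * g s) := by
  obtain ⟨C, hC0, hC⟩ := hf.exists_pos
  obtain ⟨D, hD0, hD⟩ := hg.exists_pos
  refine ⟨C * D, fun s h1 h2 => ?_⟩
  rw [norm_mul, add_mul, Real.exp_add]
  calc _ ≤ (C * Real.exp (r * |s.im|)) * (D * Real.exp (r' * |s.im|)) := by
        gcongr
        exacts [hC s h1 h2, hD s h1 h2]
    _ = _ := by ring

lemma mono (hf : ExpBoundOn σ₁ σ₂ r f) (h : r ≤ r') : ExpBoundOn σ₁ σ₂ r' f := by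
  obtain ⟨C, hC0, hC⟩ := hf.exists_pos
  refine ⟨C, fun s h1 h2 => (hC s h1 h2).trans ?_⟩
  gcongr

lemma sub (hf : ExpBoundOn σ₁ σ₂ r f) (hg : ExpBoundOn σ₁ σ₂ r g) :
    ExpBoundOn σ₁ σ₂ r (fun s => f s - g s) := by
  obtain ⟨C, hC⟩ := hf
  obtain ⟨D, hD⟩ := hg
  refine ⟨C + D, fun s h1 h2 => (norm_sub_le _ _).trans ?_⟩
  rw [add_mul]
  exact add_le_add (hC s h1 h2) (hD s h1 h2)

lemma const (c : ℂ) : ExpBoundOn σ₁ σ₂ 0 (fun _ => c) := ⟨‖c‖, by simp⟩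

lemma prod {ι : Type*} (S : Finset ι) {r : ι → ℝ} {f : ι → ℂ → ℂ}
    (h : ∀ i ∈ S, ExpBoundOn σ₁ σ₂ (r i) (f i)) :
    ExpBoundOn σ₁ σ₂ (∑ i ∈ S, r i) (fun s => ∏ i ∈ S, f i s) := by
  classical
  induction S using Finset.induction_on with
  | empty => simpa using const 1
  | insert i S hi ih =>
    simp only [Finset.sum_insert hi, Finset.prod_insert hi]
    exact (h i (by simp)).mul (ih fun j hj => h j (by simp [hj]))

lemma comp_affine {b β : ℝ} (hβ : 0 < β)
    (hf : ExpBoundOn (b + β * σ₁) (b + β * σ₂) r f) :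
    ExpBoundOn σ₁ σ₂ (r * β) (fun s => f (b + β * s)) := by
  obtain ⟨C, hC⟩ := hf
  refine ⟨C, fun s h1 h2 => ?_⟩
  have := hC (b + β * s) (by simpa using mul_le_mul_of_nonneg_left h1 hβ.le)
    (by simpa using mul_le_mul_of_nonneg_left h2 hβ.le)
  simpa [abs_mul, abs_of_pos hβ, mul_assoc] using this

lemma self {δ : ℝ} (hδ : 0 < δ) : ExpBoundOn σ₁ σ₂ δ (fun s => s) := by
  refine ⟨|σ₁| + |σ₂| + δ⁻¹, fun s h1 h2 => (Complex.norm_le_abs_re_add_abs_im s).trans ?_⟩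
  have h3 : |s.re| ≤ |σ₁| + |σ₂| := abs_le.2
    ⟨by linarith [neg_abs_le σ₁, abs_nonneg σ₂], by linarith [le_abs_self σ₂, abs_nonneg σ₁]⟩
  have h4 := Real.add_one_le_exp (δ * |s.im|)
  have h5 : |s.im| ≤ δ⁻¹ * Real.exp (δ * |s.im|) := by
    rw [inv_mul_eq_div, le_div_iff₀ hδ]; linarith
  have h6 : 1 ≤ Real.exp (δ * |s.im|) := Real.one_le_exp (by positivity)
  have h7 := mul_le_mul_of_nonneg_left h6 (by positivity : 0 ≤ |σ₁| + |σ₂|)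
  linarith

lemma exp_mul_real (u : ℝ) : ExpBoundOn σ₁ σ₂ 0 (fun s => Complex.exp (-s * u)) := by
  refine ⟨Real.exp (|σ₁ * u| + |σ₂ * u|), fun s h1 h2 => ?_⟩
  rw [Complex.norm_exp, zero_mul, Real.exp_zero, mul_one]
  apply Real.exp_le_exp.2
  have : (-s * (u : ℂ)).re = -s.re * u := by simp
  rw [this]
  rcases le_total 0 u with hu | hu
  · nlinarith [neg_abs_le (σ₁ * u), abs_nonneg (σ₂ * u)]
  · nlinarith [neg_abs_le (σ₂ * u), abs_nonneg (σ₁ * u)]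

end ExpBoundOn

lemma expBoundOn_Gamma_of_nat {δ : ℝ} (hδ : 0 < δ) (n : ℕ) :
    ExpBoundOn (1 / 2 + n) (1 / 2 + n) (-(π / 2) + δ) Complex.Gamma := by
  induction n generalizing δ with
  | zero =>
    refine ⟨√(2 * π), fun s h1 h2 => ?_⟩
    have hs : s = ((1 / 2 : ℝ) : ℂ) + s.im * Complex.I := by
      apply Complex.ext
      · simp at h1 h2 ⊢; linarith
      · simp
    have := norm_Gamma_half_le s.im
    rw [← hs] at this
    refine this.trans ?_
    gcongr
    nlinarith [abs_nonneg s.im]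
  | succ n ih =>
    obtain ⟨C, hC0, hC⟩ := ((ExpBoundOn.self (half_pos hδ)).mul (ih (half_pos hδ))).exists_pos
    refine ⟨C, fun s h1 h2 => ?_⟩
    have h0 : s - 1 ≠ 0 := by
      intro h
      have := congrArg Complex.re h
      push_cast at h1
      simp at this
      have hn : (0 : ℝ) ≤ n := n.cast_nonneg
      linarith
    have h3 := hC (s - 1) (by push_cast at h1; simp; linarith) (by push_cast at h2; simp; linarith)
    have h4 := Complex.Gamma_add_one (s - 1) h0
    rw [sub_add_cancel] at h4
    rw [h4]
    refine h3.trans (le_of_eq ?_)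
    simp only [Complex.sub_im, Complex.one_im, sub_zero]
    congr 2
    ring

lemma expBoundOn_Gamma {σ₁ σ₂ δ : ℝ} (hσ : 0 < σ₁) (hδ : 0 < δ) :
    ExpBoundOn σ₁ σ₂ (-(π / 2) + δ) Complex.Gamma := by
  obtain ⟨n, hn⟩ := exists_nat_ge σ₂
  obtain ⟨C, hC0, hC⟩ := (expBoundOn_Gamma_of_nat hδ n).exists_pos
  obtain ⟨M, hM⟩ := (isCompact_Icc (a := σ₁) (b := σ₂)).exists_bound_of_continuousOn
    (f := Real.Gamma) (Real.differentiableOn_Gamma_Ioi.continuousOn.mono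
      fun x hx => hσ.trans_le hx.1)
  set τ : ℝ := 1 / 2 + n
  have hτ : 0 < Real.Gamma τ := Real.Gamma_pos_of_pos (by positivity)
  refine ⟨C * M / Real.Gamma τ, fun s h1 h2 => ?_⟩
  have h := norm_Gamma_mul_Gamma_le (hσ.trans_le h1) (τ := τ) (by simp only [τ]; linarith) s.im
  rw [Complex.re_add_im] at h
  have h3 := hC (τ + s.im * Complex.I) (by simp [τ]) (by simp [τ])
  have h4 := (le_abs_self _).trans (hM s.re ⟨h1, h2⟩)
  simp only [Complex.add_im, Complex.ofReal_im, Complex.mul_im, Complex.ofReal_re, Complex.I_im,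
    Complex.I_re, mul_one, mul_zero, add_zero, zero_add] at h3
  rw [div_mul_eq_mul_div, le_div_iff₀ hτ]
  refine h.trans ?_
  calc _ ≤ (C * Real.exp ((-(π / 2) + δ) * |s.im|)) * M := by
        gcongr
        exact (Real.Gamma_pos_of_pos (hσ.trans_le h1)).le
    _ = _ := by ring

lemma expBoundOn_inv_Gamma_of_nat {σ₂ δ : ℝ} (hδ : 0 < δ) (n : ℕ) :
    ExpBoundOn (1 / 2 - n) σ₂ (π / 2 + δ) (fun s => (Complex.Gamma s)⁻¹) := by
  induction n generalizing σ₂ δ with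
  | zero =>
    obtain ⟨M, hM⟩ := (isCompact_Icc (a := (1 / 2 : ℝ)) (b := σ₂)).exists_bound_of_continuousOn
      (f := fun x => (Real.Gamma x)⁻¹) ((Real.differentiableOn_Gamma_Ioi.continuousOn.mono
        fun x hx => lt_of_lt_of_le (by norm_num) hx.1).inv₀
        fun x hx => (Real.Gamma_pos_of_pos (lt_of_lt_of_le (by norm_num) hx.1)).ne')
    refine ⟨Real.Gamma (1 / 2) * M, fun s h1 h2 => ?_⟩
    simp only [Nat.cast_zero, sub_zero] at h1
    have hs0 : 0 < s.re := lt_of_lt_of_le (by norm_num) h1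
    have h := norm_Gamma_mul_Gamma_le (σ := 1 / 2) (by norm_num) h1 s.im
    rw [Complex.re_add_im] at h
    have h3 := (le_abs_self _).trans (hM s.re ⟨h1, h2⟩)
    have hG : 0 < ‖Complex.Gamma s‖ := norm_pos_iff.2 (Complex.Gamma_ne_zero_of_re_pos hs0)
    have hR := Real.Gamma_pos_of_pos hs0
    have hH : 0 < Real.Gamma (1 / 2) := Real.Gamma_pos_of_pos (by norm_num)
    have h5 := le_norm_Gamma_half s.im
    rw [norm_inv, inv_le_iff_one_le_mul₀ hG]
    have h6 : 1 ≤ Real.exp ((π / 2 + δ) * |s.im|) * Real.exp (-(π / 2 * |s.im|)) := by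
      rw [← Real.exp_add]
      apply Real.one_le_exp
      nlinarith [abs_nonneg s.im]
    have h7 : Real.exp (-(π / 2 * |s.im|)) ≤ M * (‖Complex.Gamma s‖ * Real.Gamma (1 / 2)) := by
      calc _ ≤ ‖Complex.Gamma ((1 / 2 : ℝ) + s.im * Complex.I)‖ := h5
        _ = (Real.Gamma s.re)⁻¹ *
          (‖Complex.Gamma ((1 / 2 : ℝ) + s.im * Complex.I)‖ * Real.Gamma s.re) := by
            field_simp
        _ ≤ (Real.Gamma s.re)⁻¹ * (‖Complex.Gamma s‖ * Real.Gamma (1 / 2)) := by gcongr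
        _ ≤ _ := by gcongr
    calc 1 ≤ _ := h6
      _ ≤ Real.exp ((π / 2 + δ) * |s.im|) * (M * (‖Complex.Gamma s‖ * Real.Gamma (1 / 2))) := by
        gcongr
      _ = _ := by ring
  | succ n ih =>
    obtain ⟨C, hC⟩ := ih (σ₂ := σ₂ + 1) (half_pos hδ)
    have h1 : ExpBoundOn (1 / 2 - (n + 1 : ℕ)) σ₂ (π / 2 + δ / 2)
        (fun s => (Complex.Gamma (s + 1))⁻¹) := by
      refine ⟨C, fun s h1 h2 => ?_⟩
      have := hC (s + 1) (by push_cast at h1; simp; linarith) (by simp; linarith)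
      simpa using this
    have h2 := (ExpBoundOn.self (half_pos hδ)).mul h1
    rw [show δ / 2 + (π / 2 + δ / 2) = π / 2 + δ by ring] at h2
    simpa only [← Complex.one_div_Gamma_eq_self_mul_one_div_Gamma_add_one] using h2

lemma expBoundOn_inv_Gamma (σ₁ σ₂ : ℝ) {δ : ℝ} (hδ : 0 < δ) :
    ExpBoundOn σ₁ σ₂ (π / 2 + δ) (fun s => (Complex.Gamma s)⁻¹) := by
  obtain ⟨n, hn⟩ := exists_nat_ge (1 / 2 - σ₁)
  obtain ⟨C, hC⟩ := expBoundOn_inv_Gamma_of_nat (σ₂ := σ₂) hδ n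
  exact ⟨C, fun s h1 h2 => hC s (by linarith) h2⟩

lemma integrable_exp_neg_mul_abs {κ : ℝ} (hκ : 0 < κ) :
    Integrable (fun t : ℝ => Real.exp (-κ * |t|)) := by
  refine ((integrable_inv_one_add_sq.comp_mul_left' (half_pos hκ).ne').mono'
    (by fun_prop) (Filter.Eventually.of_forall fun t => ?_))
  rw [Real.norm_of_nonneg (Real.exp_pos _).le, neg_mul, Real.exp_neg]
  have h := Real.quadratic_le_exp_of_nonneg (by positivity : 0 ≤ κ * |t|)
  refine inv_anti₀ (by positivity) (le_trans ?_ h)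
  have : (κ * |t|) ^ 2 = (κ * t) ^ 2 := by rw [mul_pow, sq_abs, mul_pow]
  have h2 : 0 ≤ κ * |t| := by positivity
  nlinarith [sq_nonneg (κ * t)]

namespace ExpBoundOn

variable {σ₁ σ₂ r κ : ℝ} {f : ℂ → ℂ}

lemma integrable_vertical (hκ : 0 < κ) (hf : ExpBoundOn σ₁ σ₂ (-κ) f)
    (hc : ContinuousOn f {s | σ₁ ≤ s.re ∧ s.re ≤ σ₂}) {σ : ℝ} (h1 : σ₁ ≤ σ) (h2 : σ ≤ σ₂) :
    Integrable (fun t : ℝ => f (σ + t * Complex.I)) := by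
  obtain ⟨C, hC⟩ := hf
  have hcont : Continuous (fun t : ℝ => f (σ + t * Complex.I)) :=
    hc.comp_continuous (by fun_prop) (by simp [h1, h2])
  refine ((integrable_exp_neg_mul_abs hκ).const_mul C).mono' hcont.aestronglyMeasurable
    (Filter.Eventually.of_forall fun t => ?_)
  simpa using hC (σ + t * Complex.I) (by simpa using h1) (by simpa using h2)

/-- Shifting a vertical contour of integration across a strip of holomorphy. -/
lemma integral_vertical_eq (hκ : 0 < κ) (hσ : σ₁ ≤ σ₂) (hf : ExpBoundOn σ₁ σ₂ (-κ) f)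
    (hd : DifferentiableOn ℂ f {s | σ₁ ≤ s.re ∧ s.re ≤ σ₂}) :
    ∫ t : ℝ, f (σ₂ + t * Complex.I) = ∫ t : ℝ, f (σ₁ + t * Complex.I) := by
  have i1 := hf.integrable_vertical hκ hd.continuousOn le_rfl hσ
  have i2 := hf.integrable_vertical hκ hd.continuousOn hσ le_rfl
  obtain ⟨C, hC⟩ := hf
  have hrect : ∀ T : ℝ, (∫ x : ℝ in σ₁..σ₂, f (x + (-T : ℝ) * Complex.I)) -
      (∫ x : ℝ in σ₁..σ₂, f (x + T * Complex.I)) +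
      Complex.I • (∫ y : ℝ in (-T)..T, f (σ₂ + y * Complex.I)) -
      Complex.I • (∫ y : ℝ in (-T)..T, f (σ₁ + y * Complex.I)) = 0 := by
    intro T
    have := Complex.integral_boundary_rect_eq_zero_of_differentiableOn f
      (σ₁ + (-T : ℝ) * Complex.I) (σ₂ + T * Complex.I) (hd.mono fun s hs => by
        have h := hs.1
        simp only [Set.mem_preimage] at h
        simpa [Set.uIcc_of_le hσ] using h)
    simpa using this
  have hhor : ∀ e : ℝ, |e| = 1 → Tendsto (fun T : ℝ =>
      ∫ x : ℝ in σ₁..σ₂, f (x + (e * T : ℝ) * Complex.I)) atTop (nhds 0) := by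
    intro e he
    have hlim : Tendsto (fun T : ℝ => C * Real.exp (-(κ * T)) * |σ₂ - σ₁|) atTop (nhds 0) := by
      have : Tendsto (fun T : ℝ => Real.exp (-(κ * T))) atTop (nhds 0) :=
        Real.tendsto_exp_neg_atTop_nhds_zero.comp (tendsto_id.const_mul_atTop hκ)
      simpa using (this.const_mul C).mul_const |σ₂ - σ₁|
    refine squeeze_zero_norm' ?_ hlim
    filter_upwards [eventually_ge_atTop 0] with T hT
    refine intervalIntegral.norm_integral_le_of_norm_le_const fun x hx => ?_
    rw [Set.uIoc_of_le hσ] at hx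
    have := hC (x + (e * T : ℝ) * Complex.I) (by simpa using hx.1.le) (by simpa using hx.2)
    have him : (x + (e * T : ℝ) * Complex.I : ℂ).im = e * T := by
      simp [-Complex.ofReal_mul]
    rw [him, abs_mul, he, one_mul, abs_of_nonneg hT] at this
    simpa using this
  have l1 := hhor (-1) (by simp)
  have l2 := hhor 1 (by simp)
  simp only [neg_mul, one_mul] at l1 l2
  have l3 := (intervalIntegral_tendsto_integral i2 tendsto_neg_atTop_atBot tendsto_id).const_smul
    Complex.I
  have l4 := (intervalIntegral_tendsto_integral i1 tendsto_neg_atTop_atBot tendsto_id).const_smul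
    Complex.I
  have l5 := ((l1.sub l2).add l3).sub l4
  simp only [id] at l5
  simp only [hrect] at l5
  have := tendsto_nhds_unique l5 tendsto_const_nhds
  simp only [sub_zero, zero_add, smul_eq_mul, ← mul_sub, mul_eq_zero, Complex.I_ne_zero,
    false_or] at this
  exact sub_eq_zero.1 this

lemma dslope {x₀ : ℝ} (hf : ExpBoundOn σ₁ σ₂ r f)
    (hd : DifferentiableOn ℂ (dslope f x₀) {s | σ₁ ≤ s.re ∧ s.re ≤ σ₂}) (h0 : f x₀ = 0) :
    ExpBoundOn σ₁ σ₂ r (dslope f x₀) := by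
  obtain ⟨C, hC0, hC⟩ := hf.exists_pos
  obtain ⟨M, hM⟩ := (isCompact_Icc (a := σ₁) (b := σ₂)).reProdIm
    (isCompact_Icc (a := (-1 : ℝ)) (b := 1)) |>.exists_bound_of_continuousOn
    (hd.continuousOn.mono fun s hs => hs.1)
  refine ⟨|M| * Real.exp |r| + C, fun s h1 h2 => ?_⟩
  rw [add_mul]
  rcases le_or_gt |s.im| 1 with him | him
  · have h3 := hM s ⟨⟨h1, h2⟩, abs_le.1 him⟩
    have h4 : 1 ≤ Real.exp |r| * Real.exp (r * |s.im|) := by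
      rw [← Real.exp_add]
      apply Real.one_le_exp
      nlinarith [neg_abs_le r, abs_nonneg r, abs_nonneg s.im]
    have h5 := mul_le_mul_of_nonneg_left h4 (abs_nonneg M)
    have h6 := mul_pos hC0 (Real.exp_pos (r * |s.im|))
    linarith [le_abs_self M]
  · have hne : s ≠ x₀ := by
      rintro rfl
      simp at him
      linarith
    have h3 : 1 ≤ ‖s - x₀‖ := by
      refine him.le.trans ?_
      simpa using Complex.abs_im_le_norm (s - x₀)
    rw [dslope_of_ne _ hne, slope_def_module, h0, sub_zero, norm_smul, norm_inv]
    have h4 : ‖s - x₀‖⁻¹ * ‖f s‖ ≤ 1 * ‖f s‖ := by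
      gcongr
      exact inv_le_one_of_one_le₀ h3
    have h5 : 0 ≤ |M| * Real.exp |r| * Real.exp (r * |s.im|) := by positivity
    linarith [hC s h1 h2]

end ExpBoundOn

lemma differentiableAt_Gamma_of_re_pos {s : ℂ} (hs : 0 < s.re) :
    DifferentiableAt ℂ Complex.Gamma s :=
  Complex.differentiableAt_Gamma s fun n h => by
    have := congrArg Complex.re h
    simp at this
    have hn : (0 : ℝ) ≤ n := n.cast_nonneg
    linarith

lemma norm_exp_neg_mul_log {x : ℝ} (hx : 0 < x) (s : ℂ) :
    ‖Complex.exp (-s * (Real.log x : ℂ))‖ = x ^ (-s.re) := by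
  rw [Complex.norm_exp, Real.rpow_def_of_pos hx]
  simp [mul_comm]

/-- The Cahen-Mellin integral, in normalised form and with a shifted argument. -/
lemma norm_integral_Gamma_mul_exp_le {x₀ γ x : ℝ} (h : x₀ < γ) (hx : 0 < x) :
    ‖∫ t : ℝ, Complex.Gamma ((γ : ℂ) + t * Complex.I - x₀) *
      Complex.exp (-((γ : ℂ) + t * Complex.I) * (Real.log x : ℂ))‖ ≤ 2 * π * x ^ (-x₀) := by
  have hδ : 0 < γ - x₀ := sub_pos.2 h
  have hmel : ∀ s : ℂ, 0 < s.re →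
      mellin (fun y : ℝ => (Real.exp (-y) : ℂ)) s = Complex.Gamma s := fun s hs => by
    rw [Complex.Gamma_eq_integral hs, Complex.GammaIntegral_eq_mellin]
  have hconv : MellinConvergent (fun y : ℝ => (Real.exp (-y) : ℂ)) ((γ - x₀ : ℝ) : ℂ) := by
    have := Complex.GammaIntegral_convergent (s := ((γ - x₀ : ℝ) : ℂ)) (by simpa using hδ)
    simpa only [MellinConvergent, smul_eq_mul, mul_comm] using this
  have hint : Integrable (fun t : ℝ => Complex.Gamma ((γ - x₀ : ℝ) + t * Complex.I)) := by
    have hb := expBoundOn_Gamma (σ₁ := γ - x₀) (σ₂ := γ - x₀) hδ (by norm_num : (0 : ℝ) < 1)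
    rw [show -(π / 2) + 1 = -(π / 2 - 1) by ring] at hb
    refine hb.integrable_vertical (by linarith [Real.pi_gt_three]) (fun s hs => ?_) le_rfl le_rfl
    exact (differentiableAt_Gamma_of_re_pos (hδ.trans_le hs.1)).continuousAt.continuousWithinAt
  have hline : ∀ t : ℝ, mellin (fun y : ℝ => (Real.exp (-y) : ℂ)) ((γ - x₀ : ℝ) + t * Complex.I) =
      Complex.Gamma ((γ - x₀ : ℝ) + t * Complex.I) := fun t => hmel _ (by simpa using hδ)
  have hinv := mellinInv_mellin_eq (γ - x₀) (fun y : ℝ => (Real.exp (-y) : ℂ)) hx hconv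
    (by simpa only [Complex.VerticalIntegrable, hline] using hint)
    (by fun_prop)
  simp only [mellinInv, hline, smul_eq_mul] at hinv
  have hx0 : (x : ℂ) ≠ 0 := Complex.ofReal_ne_zero.2 hx.ne'
  have hrew : ∀ t : ℝ, Complex.Gamma ((γ : ℂ) + t * Complex.I - x₀) *
      Complex.exp (-((γ : ℂ) + t * Complex.I) * (Real.log x : ℂ)) =
      Complex.exp (-(x₀ : ℂ) * (Real.log x : ℂ)) *
      ((x : ℂ) ^ (-(((γ - x₀ : ℝ) : ℂ) + t * Complex.I)) *
        Complex.Gamma ((γ - x₀ : ℝ) + t * Complex.I)) := by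
    intro t
    rw [Complex.cpow_def_of_ne_zero hx0, ← Complex.ofReal_log hx.le, ← mul_assoc,
      ← Complex.exp_add, mul_comm]
    congr 2 <;> push_cast <;> ring
  simp only [hrew]
  rw [integral_const_mul, norm_mul, norm_exp_neg_mul_log hx]
  have hn := congrArg norm hinv
  rw [norm_smul, Complex.norm_real, Real.norm_of_nonneg (by positivity),
    Real.norm_of_nonneg (Real.exp_pos _).le] at hn
  have he : Real.exp (-x) ≤ 1 := Real.exp_le_one_iff.2 (by linarith)
  rw [← hn, one_div, inv_mul_le_iff₀ (by positivity), mul_one] at he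
  rw [Complex.ofReal_re, mul_comm]
  gcongr

/-- An inverse Mellin transform whose kernel has a single simple pole at `x₀` in the strip
`c ≤ Re s ≤ γ` is `O(x ^ (-x₀))` at the origin. -/
lemma isBigO_integral_of_simple_pole {K N : ℂ → ℂ} {c x₀ γ κ : ℝ} (hκ : 0 < κ)
    (hc1 : x₀ - 1 < c) (hc : c < x₀) (hγ : x₀ < γ)
    (hN : DifferentiableOn ℂ N {s | c ≤ s.re ∧ s.re ≤ γ}) (hb : ExpBoundOn c γ (-κ) N)
    (hK : ∀ t : ℝ, K (γ + t * Complex.I) =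
      N (γ + t * Complex.I) / (γ + t * Complex.I - x₀)) :
    (fun x : ℝ => ∫ t : ℝ, K ((γ : ℂ) + (t : ℂ) * Complex.I) *
      Complex.exp (-((γ : ℂ) + (t : ℂ) * Complex.I) * (Real.log x : ℂ)))
      =O[nhdsWithin 0 (Set.Ioi 0)] fun x : ℝ => x ^ (-x₀) := by
  set S : Set ℂ := {s | c ≤ s.re ∧ s.re ≤ γ}
  have hcγ : c ≤ γ := (hc.trans hγ).le
  set κ' := min κ (1 / 2)
  have hκ'2 : κ' ≤ 1 / 2 := min_le_right _ _
  have hκ'0 : 0 < κ' := lt_min hκ (by norm_num)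
  set R := N x₀
  set G : ℂ → ℂ := fun s => N s - R * Complex.Gamma (s - x₀ + 1)
  have hGd : DifferentiableOn ℂ G S := by
    refine hN.sub (DifferentiableOn.const_mul (fun s hs => ?_) R)
    have : DifferentiableAt ℂ Complex.Gamma (s - x₀ + 1) :=
      differentiableAt_Gamma_of_re_pos (by simp; linarith [hs.1])
    exact (this.comp s (by fun_prop :
      DifferentiableAt ℂ (fun s : ℂ => s - x₀ + 1) s)).differentiableWithinAt
  have hGb : ExpBoundOn c γ (-κ') G := by
    have h1 : ExpBoundOn ((1 - x₀) + 1 * c) ((1 - x₀) + 1 * γ) (-(π / 2) + 1) Complex.Gamma :=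
      expBoundOn_Gamma (by linarith) one_pos
    have h2 := (ExpBoundOn.const (σ₁ := c) (σ₂ := γ) R).mul
      (ExpBoundOn.comp_affine (b := 1 - x₀) one_pos h1)
    have harg : ∀ s : ℂ, ((1 - x₀ : ℝ) : ℂ) + (1 : ℝ) * s = s - x₀ + 1 := fun s => by
      push_cast
      ring
    simp only [harg] at h2
    exact (hb.mono (neg_le_neg (min_le_left _ _))).sub
      (h2.mono (by linarith [Real.pi_gt_three]))
  have hG0 : G x₀ = 0 := by simp [G, R]
  set F := dslope G x₀
  have hSn : S ∈ nhds (x₀ : ℂ) := by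
    have h1 : ∀ᶠ s : ℂ in nhds (x₀ : ℂ), c < s.re :=
      Complex.continuous_re.continuousAt.eventually (lt_mem_nhds (by simpa using hc))
    have h2 : ∀ᶠ s : ℂ in nhds (x₀ : ℂ), s.re < γ :=
      Complex.continuous_re.continuousAt.eventually (gt_mem_nhds (by simpa using hγ))
    filter_upwards [h1, h2] with s a b using ⟨a.le, b.le⟩
  have hFd : DifferentiableOn ℂ F S := (Complex.differentiableOn_dslope hSn).2 hGd
  have hFb : ExpBoundOn c γ (-κ') F := hGb.dslope hFd hG0
  have hsplit : ∀ t : ℝ, K (γ + t * Complex.I) = F (γ + t * Complex.I) +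
      R * Complex.Gamma (γ + t * Complex.I - x₀) := by
    intro t
    have hne : (γ : ℂ) + t * Complex.I ≠ x₀ := by
      intro h
      have := congrArg Complex.re h
      simp at this
      linarith
    have hne' := sub_ne_zero.2 hne
    simp only [F]
    rw [hK, dslope_of_ne _ hne, slope_def_module, hG0, sub_zero, smul_eq_mul]
    simp only [G]
    rw [Complex.Gamma_add_one _ hne']
    field_simp
    ring
  have hexp : ∀ u : ℝ, DifferentiableOn ℂ (fun s : ℂ => Complex.exp (-s * u)) S := fun u => by
    fun_prop
  have hΓd : DifferentiableOn ℂ (fun s : ℂ => Complex.Gamma (s - x₀)) {s | γ ≤ s.re ∧ s.re ≤ γ} := by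
    intro s hs
    have : DifferentiableAt ℂ Complex.Gamma (s - x₀) :=
      differentiableAt_Gamma_of_re_pos (by simp; linarith [hs.1])
    exact (this.comp s (by fun_prop :
      DifferentiableAt ℂ (fun s : ℂ => s - x₀) s)).differentiableWithinAt
  have hΓb : ExpBoundOn γ γ (-(1 / 2)) (fun s : ℂ => Complex.Gamma (s - x₀)) := by
    have h1 : ExpBoundOn (-x₀ + 1 * γ) (-x₀ + 1 * γ) (-(π / 2) + 1) Complex.Gamma :=
      expBoundOn_Gamma (by linarith) one_pos
    have h2 := (ExpBoundOn.comp_affine (b := -x₀) one_pos h1).mono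
      (r' := -(1 / 2)) (by linarith [Real.pi_gt_three])
    have harg : ∀ s : ℂ, ((-x₀ : ℝ) : ℂ) + (1 : ℝ) * s = s - x₀ := fun s => by
      push_cast
      ring
    simpa only [harg] using h2
  refine IsBigO.of_bound ((∫ t : ℝ, ‖F (c + t * Complex.I)‖) + ‖R‖ * (2 * π)) ?_
  filter_upwards [Ioo_mem_nhdsGT (zero_lt_one' ℝ)] with x hx
  have hx0 : 0 < x := hx.1
  have hFe := hFb.mul (ExpBoundOn.exp_mul_real (σ₁ := c) (σ₂ := γ) (Real.log x))
  rw [add_zero] at hFe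
  have hFed := hFd.mul (hexp (Real.log x))
  have hΓe := hΓb.mul (ExpBoundOn.exp_mul_real (σ₁ := γ) (σ₂ := γ) (Real.log x))
  rw [add_zero] at hΓe
  have i1 := hFe.integrable_vertical hκ'0 hFed.continuousOn hcγ le_rfl
  have i2 := hΓe.integrable_vertical (by norm_num)
    (hΓd.continuousOn.mul (by fun_prop)) le_rfl le_rfl
  have hshift := hFe.integral_vertical_eq hκ'0 hcγ hFed
  have heq : ∫ t : ℝ, K ((γ : ℂ) + (t : ℂ) * Complex.I) *
      Complex.exp (-((γ : ℂ) + (t : ℂ) * Complex.I) * (Real.log x : ℂ)) =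
      (∫ t : ℝ, F ((c : ℂ) + (t : ℂ) * Complex.I) *
        Complex.exp (-((c : ℂ) + (t : ℂ) * Complex.I) * (Real.log x : ℂ))) +
      R * ∫ t : ℝ, Complex.Gamma ((γ : ℂ) + t * Complex.I - x₀) *
        Complex.exp (-((γ : ℂ) + t * Complex.I) * (Real.log x : ℂ)) := by
    rw [← hshift, ← integral_const_mul, ← integral_add i1 (i2.const_mul R)]
    refine integral_congr_ae (Filter.Eventually.of_forall fun t => ?_)
    simp only [hsplit]
    ring
  have hxx : x ^ (-c) ≤ x ^ (-x₀) :=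
    Real.rpow_le_rpow_of_exponent_ge hx0 hx.2.le (by linarith)
  have hfirst : ‖∫ t : ℝ, F ((c : ℂ) + (t : ℂ) * Complex.I) *
        Complex.exp (-((c : ℂ) + (t : ℂ) * Complex.I) * (Real.log x : ℂ))‖ ≤
      (∫ t : ℝ, ‖F (c + t * Complex.I)‖) * x ^ (-x₀) := by
    refine (norm_integral_le_integral_norm _).trans ?_
    have : ∀ t : ℝ, ‖F ((c : ℂ) + (t : ℂ) * Complex.I) *
        Complex.exp (-((c : ℂ) + (t : ℂ) * Complex.I) * (Real.log x : ℂ))‖ =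
        ‖F (c + t * Complex.I)‖ * x ^ (-c) := fun t => by
      rw [norm_mul, norm_exp_neg_mul_log hx0]
      simp
    simp only [this]
    rw [integral_mul_const]
    gcongr
  rw [heq, Real.norm_of_nonneg (Real.rpow_nonneg hx0.le _), add_mul]
  refine (norm_add_le _ _).trans (add_le_add hfirst ?_)
  rw [norm_mul, mul_assoc]
  gcongr
  exact norm_integral_Gamma_mul_exp_le hγ hx0

/-- The Fox-H kernel with the factor `1 / (s + b k / β k)` carrying the pole of its `k`-th
numerator factor removed. -/
noncomputable def foxKernelNumerator (m p : ℕ) (a α b β : ℕ → ℝ) (k : ℕ) (s : ℂ) : ℂ :=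
  (β k : ℂ)⁻¹ * Complex.Gamma ((b k + 1 : ℝ) + β k * s) *
    (∏ j ∈ (Finset.range m).erase k, Complex.Gamma (b j + β j * s)) *
    ∏ i ∈ Finset.range p, (Complex.Gamma (a i + α i * s))⁻¹

lemma foxKernelM_eq_div {m p : ℕ} {a α b β : ℕ → ℝ} {k : ℕ} (hk : k < m) (hβ : 0 < β k) {s : ℂ}
    (hs : s - ((-(b k / β k) : ℝ) : ℂ) ≠ 0) :
    foxKernelM m p a α b β s =
      foxKernelNumerator m p a α b β k s / (s - ((-(b k / β k) : ℝ) : ℂ)) := by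
  have hβ' : (β k : ℂ) ≠ 0 := Complex.ofReal_ne_zero.2 hβ.ne'
  have harg : (b k : ℂ) + β k * s = β k * (s - ((-(b k / β k) : ℝ) : ℂ)) := by
    push_cast
    field_simp
    ring
  have hrec : Complex.Gamma ((b k + 1 : ℝ) + β k * s) =
      β k * (s - ((-(b k / β k) : ℝ) : ℂ)) * Complex.Gamma (b k + β k * s) := by
    rw [← harg, ← Complex.Gamma_add_one _ (harg ▸ mul_ne_zero hβ' hs)]
    congr 1
    push_cast
    ring
  rw [foxKernelM, foxKernelNumerator, hrec,
    ← Finset.mul_prod_erase (Finset.range m) _ (Finset.mem_range.2 hk), Finset.prod_inv_distrib]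
  generalize s - ((-(b k / β k) : ℝ) : ℂ) = z at hs
  field_simp

lemma differentiableOn_foxKernelNumerator {m p : ℕ} {a α b β : ℕ → ℝ} {k : ℕ} {c γ : ℝ}
    (hβ : ∀ j < m, 0 < β j) (hk : k < m) (hck : 0 < b k + 1 + β k * c)
    (hcj : ∀ j < m, j ≠ k → 0 < b j + β j * c) :
    DifferentiableOn ℂ (foxKernelNumerator m p a α b β k) {s | c ≤ s.re ∧ s.re ≤ γ} := by
  intro s hs
  have hG : ∀ b' β' : ℝ, 0 < β' → 0 < b' + β' * c →
      DifferentiableAt ℂ (fun s : ℂ => Complex.Gamma (b' + β' * s)) s := by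
    intro b' β' h1 h2
    have : DifferentiableAt ℂ Complex.Gamma (b' + β' * s) := by
      apply differentiableAt_Gamma_of_re_pos
      simp
      nlinarith [hs.1]
    exact this.comp s (by fun_prop : DifferentiableAt ℂ (fun s : ℂ => (b' : ℂ) + β' * s) s)
  refine DifferentiableAt.differentiableWithinAt ?_
  refine (((hG _ _ (hβ k hk) hck).const_mul _).mul ?_).mul ?_
  · refine DifferentiableAt.fun_finsetProd fun j hj => ?_
    rw [Finset.mem_erase, Finset.mem_range] at hj
    exact hG _ _ (hβ j hj.2) (hcj j hj.2 hj.1)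
  · refine DifferentiableAt.fun_finsetProd fun i _ => ?_
    exact (Complex.differentiable_one_div_Gamma _).comp s
      (by fun_prop : DifferentiableAt ℂ (fun s : ℂ => (a i : ℂ) + α i * s) s)

lemma expBoundOn_foxKernelNumerator {m p : ℕ} {a α b β : ℕ → ℝ} {k : ℕ} {c γ δ : ℝ}
    (hα : ∀ i < p, 0 < α i) (hβ : ∀ j < m, 0 < β j) (hk : k < m) (hck : 0 < b k + 1 + β k * c)
    (hcj : ∀ j < m, j ≠ k → 0 < b j + β j * c) (hδ : 0 < δ) :
    ExpBoundOn c γ (-(π / 2) * (∑ j ∈ Finset.range m, β j - ∑ i ∈ Finset.range p, α i) +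
      δ * (∑ j ∈ Finset.range m, β j + ∑ i ∈ Finset.range p, α i))
      (foxKernelNumerator m p a α b β k) := by
  have h1 : ExpBoundOn c γ ((-(π / 2) + δ) * β k)
      (fun s => Complex.Gamma ((b k + 1 : ℝ) + β k * s)) :=
    ExpBoundOn.comp_affine (hβ k hk) (expBoundOn_Gamma hck hδ)
  have h2 := ExpBoundOn.prod (σ₁ := c) (σ₂ := γ) ((Finset.range m).erase k)
    (r := fun j => (-(π / 2) + δ) * β j) (f := fun j s => Complex.Gamma (b j + β j * s))
    fun j hj => by
      rw [Finset.mem_erase, Finset.mem_range] at hj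
      exact ExpBoundOn.comp_affine (hβ j hj.2) (expBoundOn_Gamma (hcj j hj.2 hj.1) hδ)
  have h3 := ExpBoundOn.prod (σ₁ := c) (σ₂ := γ) (Finset.range p)
    (r := fun i => (π / 2 + δ) * α i) (f := fun i s => (Complex.Gamma (a i + α i * s))⁻¹)
    fun i hi => by
      rw [Finset.mem_range] at hi
      exact ExpBoundOn.comp_affine (f := fun s => (Complex.Gamma s)⁻¹) (hα i hi)
        (expBoundOn_inv_Gamma _ _ hδ)
  refine ((((ExpBoundOn.const _).mul h1).mul h2).mul h3).mono (le_of_eq ?_)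
  rw [← Finset.mul_sum, ← Finset.mul_sum, ← Finset.add_sum_erase _ β (Finset.mem_range.2 hk)]
  ring

/-- behaviour of Fox-H functions of type `(m,0;p,m)` at `0⁺`:
with `ρ = min_{1≤j≤m} bⱼ/βⱼ` one has `ρ > -1` and `H(x) = O(x^ρ)` as `x → 0⁺`. -/
theorem foxH_asymptotics_zero
    (m p : ℕ) (hm : 1 ≤ m)
    (a α b β : ℕ → ℝ)
    (hα : ∀ i < p, 0 < α i) (hβ : ∀ j < m, 0 < β j)
    (hb : ∀ j < m, 0 < b j + β j) (ha : ∀ i < p, 0 < a i + α i)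
    (hΔpos : 0 < ∑ j ∈ Finset.range m, β j - ∑ i ∈ Finset.range p, α i)
    (hbsimple : ∀ j < m, ∀ j' < m, ∀ l l' : ℕ,
      -(b j + l) / β j = -(b j' + l') / β j' → j = j' ∧ l = l')
    (γ : ℝ) (hγ : ∀ j < m, -(b j) / β j < γ)
    (ρ : ℝ)
    (hρ : ρ = (Finset.range m).inf' (Finset.nonempty_range_iff.mpr (by omega))
      fun j => b j / β j) :
    -1 < ρ ∧
    (fun x : ℝ => foxHposM m p a α b β γ x) =O[nhdsWithin 0 (Set.Ioi 0)]
      fun x : ℝ => x ^ ρ := by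
  obtain ⟨k, hkm, hkρ⟩ := Finset.exists_mem_eq_inf'
    (Finset.nonempty_range_iff.mpr (by omega : m ≠ 0)) (fun j => b j / β j)
  rw [hkρ] at hρ
  have hk : k < m := Finset.mem_range.1 hkm
  have hβk := hβ k hk
  have hmin : ∀ j < m, j ≠ k → ρ < b j / β j := by
    intro j hj hjk
    refine lt_of_le_of_ne ?_ fun h => hjk ?_
    · rw [hρ, ← hkρ]
      exact Finset.inf'_le _ (Finset.mem_range.2 hj)
    · refine (hbsimple j hj k hk 0 0 ?_).1
      simp only [Nat.cast_zero, add_zero, neg_div]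
      rw [← h, hρ]
  refine ⟨?_, ?_⟩
  · rw [hρ, lt_div_iff₀ hβk]
    linarith [hb k hk]
  have hev : ∀ᶠ c in nhdsWithin (-ρ) (Set.Iio (-ρ)),
      c < -ρ ∧ -ρ - 1 < c ∧ 0 < b k + 1 + β k * c ∧
      ∀ j ∈ Finset.range m, j ≠ k → 0 < b j + β j * c := by
    refine eventually_mem_nhdsWithin.and (Filter.Eventually.filter_mono nhdsWithin_le_nhds ?_)
    refine (lt_mem_nhds (by linarith)).and (Filter.Eventually.and ?_ ?_)
    · refine (by fun_prop : Continuous fun c => b k + 1 + β k * c).continuousAt.eventually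
        (lt_mem_nhds ?_)
      simp [hρ, mul_div_cancel₀ _ hβk.ne']
    · rw [Filter.eventually_all_finset]
      intro j hj
      by_cases hjk : j = k
      · simp [hjk]
      have hj' := Finset.mem_range.1 hj
      have : 0 < b j + β j * -ρ := by
        have := (lt_div_iff₀ (hβ j hj')).1 (hmin j hj' hjk)
        linarith
      filter_upwards [(by fun_prop : Continuous fun c => b j + β j * c).continuousAt.eventually
        (lt_mem_nhds this)] with c hc _ using hc
  obtain ⟨c, hc, hc1, hck, hcj⟩ := hev.exists
  replace hcj : ∀ j < m, j ≠ k → 0 < b j + β j * c := fun j hj => hcj j (Finset.mem_range.2 hj)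
  have hργ : -ρ < γ := by
    have := hγ k hk
    rwa [neg_div, ← hρ] at this
  set B := ∑ j ∈ Finset.range m, β j
  set A := ∑ i ∈ Finset.range p, α i
  have hA : 0 ≤ A := Finset.sum_nonneg fun i hi => (hα i (Finset.mem_range.1 hi)).le
  have hBA : 0 < B + A := by linarith
  have hπ := Real.pi_pos
  have hbound := expBoundOn_foxKernelNumerator (a := a) (γ := γ) (δ := π / 4 * (B - A) / (B + A))
    hα hβ hk hck hcj (by positivity)
  rw [div_mul_cancel₀ _ hBA.ne', show -(π / 2) * (B - A) + π / 4 * (B - A) =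
    -(π / 4 * (B - A)) by ring] at hbound
  have hmain := isBigO_integral_of_simple_pole (K := foxKernelM m p a α b β) (x₀ := -ρ)
    (by positivity) hc1 hc hργ
    (differentiableOn_foxKernelNumerator hβ hk hck hcj) hbound (fun t => by
      rw [hρ]
      refine foxKernelM_eq_div hk hβk fun h => ?_
      have := congrArg Complex.re h
      simp at this
      rw [← hρ] at this
      linarith)
  rw [neg_neg] at hmain
  exact hmain.const_mul_left _
end
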